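/- arXiv:quant-ph/9904093 — 3 statements merged into one kernel-verified Lean document; each statement's English description precedes it below -/
import Mathlib

section
/- Entropy increase under a distinguishable random unitary step (Lemma 1, lem-mix, specialised to a two-outcome measurement): Let σ₀ and σ₁ be density matrices on ℂ^d, let σ = ½(σ₀ + σ₁), and let E be a d×d complex matrix that is positive semidefinite with E ≤ I (a two-outcome POVM element, outcome 1 corresponding to E and outcome 0 to I − E). If the average probability of correctly identifying the bit, p = ½(Tr((I − E)σ₀) + Tr(E σ₁)), then S(σ) ≥ ½(S(σ₀) + S(σ₁)) + (1 − H(p)). -/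
open Matrix
open scoped ComplexOrder

/-- The von Neumann entropy (in bits) of a matrix: `S(ρ) = −Σᵢ λᵢ log₂ λᵢ` where
the `λᵢ` are the eigenvalues of `ρ` (defined to be `0` on non-Hermitian matrices). -/
noncomputable def vnEntropy {d : ℕ} (ρ : Matrix (Fin d) (Fin d) ℂ) : ℝ :=
  if h : ρ.IsHermitian then -∑ i, h.eigenvalues i * Real.logb 2 (h.eigenvalues i) else 0

/-- The binary entropy function `H(p) = −p log₂ p − (1−p) log₂ (1−p)`. -/
noncomputable def binH (p : ℝ) : ℝ :=
  -(p * Real.logb 2 p) - (1 - p) * Real.logb 2 (1 - p)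

/-- A density matrix: Hermitian (implied by `PosSemidef`), positive semidefinite,
and of unit trace. -/
def IsDensityMatrix {d : ℕ} (ρ : Matrix (Fin d) (Fin d) ℂ) : Prop :=
  ρ.PosSemidef ∧ ρ.trace = 1

namespace Matrix

variable {n : Type*} [Fintype n]

lemma sum_mul_star_eq_trace (X Y : Matrix n n ℂ) :
    ∑ i, ∑ j, X i j * star (Y i j) = (X * Yᴴ).trace := by
  simp [trace, mul_apply]

variable [DecidableEq n]

/-- `ρ` is unitarily diagonalized by `U` with real eigenvalues `r`. -/
structure IsDiagonalizedBy (ρ U : Matrix n n ℂ) (r : n → ℝ) : Prop where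
  conjTranspose_mul_self : Uᴴ * U = 1
  mul_conjTranspose_self : U * Uᴴ = 1
  eq : U * diagonal (fun i => (r i : ℂ)) * Uᴴ = ρ

lemma IsHermitian.isDiagonalizedBy {ρ : Matrix n n ℂ} (h : ρ.IsHermitian) :
    IsDiagonalizedBy ρ (h.eigenvectorUnitary : Matrix n n ℂ) h.eigenvalues where
  conjTranspose_mul_self := Unitary.coe_star_mul_self h.eigenvectorUnitary
  mul_conjTranspose_self := Unitary.coe_mul_star_self h.eigenvectorUnitary
  eq := by
    conv_rhs => rw [h.spectral_theorem]
    rfl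

namespace IsDiagonalizedBy

variable {ρ σ U V : Matrix n n ℂ} {r s : n → ℝ}

lemma trace_eq (hρ : IsDiagonalizedBy ρ U r) : ρ.trace = ∑ i, (r i : ℂ) := by
  rw [← hρ.eq, trace_mul_comm, ← mul_assoc, hρ.conjTranspose_mul_self, one_mul, trace_diagonal]

lemma conj_eq (hρ : IsDiagonalizedBy ρ U r) : Uᴴ * ρ * U = diagonal (fun i => (r i : ℂ)) := by
  have h := hρ.conjTranspose_mul_self
  rw [← hρ.eq]
  simp only [mul_assoc, h, mul_one]
  rw [← mul_assoc, h, one_mul]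

lemma trace_mul_eq (hρ : IsDiagonalizedBy ρ U r) (A : Matrix n n ℂ) :
    (diagonal (fun i => (r i : ℂ)) * (Uᴴ * A * U)).trace = (ρ * A).trace := by
  rw [← hρ.eq, ← mul_assoc, ← mul_assoc, trace_mul_comm]
  simp only [mul_assoc]

lemma sum_sub_mul_eq_trace (hρ : IsDiagonalizedBy ρ U r) (hσ : IsDiagonalizedBy σ V s)
    {A : Matrix n n ℂ} (hA : A.IsHermitian) :
    ∑ i, ∑ j, ((r i - s j : ℝ) : ℂ) * ((Uᴴ * V) i j * star ((Uᴴ * A * V) i j)) =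
      (ρ * A).trace - (σ * A).trace := by
  have h : ∀ i j, ((r i - s j : ℝ) : ℂ) * ((Uᴴ * V) i j * star ((Uᴴ * A * V) i j)) =
      (diagonal (fun i => (r i : ℂ)) * (Uᴴ * V) - (Uᴴ * V) * diagonal (fun i => (s i : ℂ))) i j *
        star ((Uᴴ * A * V) i j) := by
    intro i j
    rw [sub_apply, diagonal_mul, mul_diagonal]
    push_cast
    ring
  simp only [h]
  rw [sum_mul_star_eq_trace, sub_mul, trace_sub]
  simp only [conjTranspose_mul, conjTranspose_conjTranspose, hA.eq]
  congr 1
  · rw [← hρ.trace_mul_eq A]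
    simp only [mul_assoc]
    rw [← mul_assoc V Vᴴ, hσ.mul_conjTranspose_self, one_mul]
  · rw [← hσ.eq, show Uᴴ * V * diagonal (fun i => (s i : ℂ)) * (Vᴴ * (A * U)) =
      Uᴴ * (V * diagonal (fun i => (s i : ℂ)) * Vᴴ * A * U) by simp only [mul_assoc],
      trace_mul_comm, mul_assoc _ U, hρ.mul_conjTranspose_self, mul_one]

lemma sum_left_mul_normSq (hρ : IsDiagonalizedBy ρ U r) (hV : V * Vᴴ = 1)
    {A : Matrix n n ℂ} (hA : A.IsHermitian) :
    ∑ i, ∑ j, r i * Complex.normSq ((Uᴴ * A * V) i j) = (ρ * (A * A)).trace.re := by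
  have h : ((∑ i, ∑ j, r i * Complex.normSq ((Uᴴ * A * V) i j) : ℝ) : ℂ) =
      (ρ * (A * A)).trace := by
    push_cast
    have h : ∀ i j, (r i : ℂ) * Complex.normSq ((Uᴴ * A * V) i j) =
        (diagonal (fun i => (r i : ℂ)) * (Uᴴ * A * V)) i j * star ((Uᴴ * A * V) i j) := by
      intro i j
      rw [diagonal_mul, Complex.star_def, ← Complex.mul_conj]
      ring
    simp only [h]
    rw [sum_mul_star_eq_trace, ← hρ.trace_mul_eq]
    simp only [conjTranspose_mul, conjTranspose_conjTranspose, hA.eq, mul_assoc]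
    rw [← mul_assoc V Vᴴ, hV, one_mul]
  rw [← h, Complex.ofReal_re]

lemma sum_right_mul_normSq (hσ : IsDiagonalizedBy σ V s) (hU : U * Uᴴ = 1)
    {A : Matrix n n ℂ} (hA : A.IsHermitian) :
    ∑ i, ∑ j, s j * Complex.normSq ((Uᴴ * A * V) i j) = (σ * (A * A)).trace.re := by
  rw [← hσ.sum_left_mul_normSq hU hA, Finset.sum_comm]
  refine Finset.sum_congr rfl fun j _ => Finset.sum_congr rfl fun i _ => ?_
  have h : (Vᴴ * A * U) j i = star ((Uᴴ * A * V) i j) := by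
    rw [← conjTranspose_apply]
    simp only [conjTranspose_mul, conjTranspose_conjTranspose, hA.eq, mul_assoc]
  rw [h, Complex.star_def, Complex.normSq_conj]

lemma sum_left_normSq (hU : U * Uᴴ = 1) (hV : Vᴴ * V = 1) (j : n) :
    ∑ i, Complex.normSq ((Uᴴ * V) i j) = 1 := by
  have h : ((Uᴴ * V)ᴴ * (Uᴴ * V)) j j = 1 := by
    simp only [conjTranspose_mul, conjTranspose_conjTranspose, mul_assoc]
    rw [← mul_assoc U, hU, one_mul, hV, one_apply_eq]
  rw [mul_apply] at h
  have h' : ((∑ i, Complex.normSq ((Uᴴ * V) i j) : ℝ) : ℂ) = 1 := by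
    rw [← h]
    push_cast
    refine Finset.sum_congr rfl fun i _ => ?_
    rw [conjTranspose_apply, mul_comm, Complex.star_def, Complex.mul_conj]
  exact_mod_cast h'

lemma sum_right_normSq (hU : Uᴴ * U = 1) (hV : V * Vᴴ = 1) (i : n) :
    ∑ j, Complex.normSq ((Uᴴ * V) i j) = 1 := by
  rw [← sum_left_normSq hV hU i]
  refine Finset.sum_congr rfl fun j _ => ?_
  have h : (Vᴴ * U) j i = star ((Uᴴ * V) i j) := by
    rw [← conjTranspose_apply]
    simp only [conjTranspose_mul, conjTranspose_conjTranspose]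
  rw [h, Complex.star_def, Complex.normSq_conj]

lemma sum_mul_normSq_eq_conj_apply (hρ : IsDiagonalizedBy ρ U r) (j : n) :
    ∑ i, r i * Complex.normSq ((Uᴴ * V) i j) = ((Vᴴ * ρ * V) j j).re := by
  have h : ((∑ i, r i * Complex.normSq ((Uᴴ * V) i j) : ℝ) : ℂ) = (Vᴴ * ρ * V) j j := by
    rw [← hρ.eq, show Vᴴ * (U * diagonal (fun i => (r i : ℂ)) * Uᴴ) * V =
      (Uᴴ * V)ᴴ * (diagonal (fun i => (r i : ℂ)) * (Uᴴ * V)) by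
        simp only [conjTranspose_mul, conjTranspose_conjTranspose, mul_assoc], mul_apply]
    push_cast
    refine Finset.sum_congr rfl fun i _ => ?_
    rw [diagonal_mul, conjTranspose_apply, Complex.star_def, ← Complex.mul_conj]
    ring
  rw [← h, Complex.ofReal_re]

end IsDiagonalizedBy

lemma PosSemidef.re_trace_mul_nonneg {ρ P : Matrix n n ℂ} (hρ : ρ.PosSemidef)
    (hP : P.PosSemidef) : 0 ≤ (ρ * P).trace.re := by
  have hd := hρ.1.isDiagonalizedBy
  rw [← hd.trace_mul_eq]
  refine (Complex.le_def.1 (Finset.sum_nonneg fun i _ => ?_)).1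
  rw [diag_apply, diagonal_mul]
  exact mul_nonneg (by exact_mod_cast hρ.eigenvalues_nonneg i)
    (hP.conjTranspose_mul_mul_same _).diag_nonneg

lemma PosSemidef.sub_mul_self {F : Matrix n n ℂ} (hF : F.PosSemidef)
    (hF' : (1 - F).PosSemidef) : (F - F * F).PosSemidef := by
  have h := (hF'.conjTranspose_mul_mul_same F).add (hF.conjTranspose_mul_mul_same (1 - F))
  rw [hF.1.eq, hF'.1.eq] at h
  convert h using 1
  noncomm_ring

end Matrix

/-- An antiderivative in `t` of `(1 - t) * (r - s) ^ 2 / ((1 - t) * s + t * r)`. -/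
noncomputable def entropyPrimitive (r s t : ℝ) : ℝ :=
  r * Real.log ((1 - t) * s + t * r) - (r - s) * t

lemma hasDerivAt_entropyPrimitive {r s t : ℝ} (hr : 0 ≤ r) (hs : 0 ≤ s) (ht0 : 0 < t)
    (ht1 : t < 1) :
    HasDerivAt (entropyPrimitive r s)
      ((1 - t) * (r - s) ^ 2 / ((1 - t) * s + t * r)) t := by
  have h1 : 0 < 1 - t := by linarith
  by_cases hr0 : r = 0
  · subst hr0
    have hd : HasDerivAt (fun t : ℝ => s * t) (s * 1) t := (hasDerivAt_id t).const_mul s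
    have hfun : entropyPrimitive 0 s = fun t => s * t := by
      funext t
      simp [entropyPrimitive]
    rw [hfun]
    convert hd using 1
    by_cases hs0 : s = 0
    · simp [hs0]
    · field_simp
      ring
  · have hr' : 0 < r := lt_of_le_of_ne hr (Ne.symm hr0)
    have hm : 0 < (1 - t) * s + t * r := by positivity
    have hd1 : HasDerivAt (fun t : ℝ => (1 - t) * s + t * r) ((-1) * s + 1 * r) t :=
      (((hasDerivAt_id t).const_sub 1).mul_const s).add ((hasDerivAt_id t).mul_const r)
    have hd : HasDerivAt (entropyPrimitive r s) _ t :=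
      ((hd1.log hm.ne').const_mul r).sub ((hasDerivAt_id t).const_mul (r - s))
    refine hd.congr_deriv (Eq.symm ?_)
    have hm' := hm.ne'
    rw [eq_sub_iff_add_eq, mul_div_assoc', div_add' _ _ _ hm']
    congr 1
    ring

lemma continuousOn_entropyPrimitive {r s : ℝ} (hr : 0 ≤ r) (hs : 0 ≤ s) (h : s = 0 → r = 0) :
    ContinuousOn (entropyPrimitive r s) (Set.Icc 0 1) := by
  unfold entropyPrimitive
  by_cases hr0 : r = 0
  · subst hr0
    simp only [zero_mul]
    fun_prop
  · have hr' : 0 < r := lt_of_le_of_ne hr (Ne.symm hr0)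
    have hs' : 0 < s := lt_of_le_of_ne hs (fun h' => hr0 (h h'.symm))
    have hm : ∀ t ∈ Set.Icc (0 : ℝ) 1, (1 - t) * s + t * r ≠ 0 := by
      rintro t ⟨h0, h1⟩
      rcases h0.eq_or_lt with rfl | h0
      · simp [hs'.ne']
      · have : 0 ≤ (1 - t) * s := mul_nonneg (by linarith) hs
        have : 0 < t * r := mul_pos h0 hr'
        linarith
    exact (continuousOn_const.mul (ContinuousOn.log (by fun_prop) hm)).sub (by fun_prop)

lemma two_mul_sub_normSq_le {r s t : ℝ} (hr : 0 ≤ r) (hs : 0 ≤ s) (ht0 : 0 < t) (ht1 : t < 1)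
    (w a : ℂ) :
    2 * ((r - s) * (w * star a).re) - ((1 - t) * s + t * r) * Complex.normSq a ≤
      Complex.normSq w * ((r - s) ^ 2 / ((1 - t) * s + t * r)) := by
  have h1 : 0 < 1 - t := by linarith
  rcases (show 0 ≤ (1 - t) * s + t * r by positivity).eq_or_lt with hm | hm
  · have hs0 : s = 0 := by
      have : (1 - t) * s = 0 := by nlinarith [mul_nonneg h1.le hs, mul_nonneg ht0.le hr]
      simpa [h1.ne'] using this
    have hr0 : r = 0 := by
      have : t * r = 0 := by nlinarith [mul_nonneg h1.le hs, mul_nonneg ht0.le hr]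
      simpa [ht0.ne'] using this
    simp [hs0, hr0]
  · rw [← mul_div_assoc, le_div_iff₀ hm]
    generalize (1 - t) * s + t * r = m
    simp only [Complex.normSq_apply, Complex.star_def, Complex.mul_re, Complex.conj_re,
      Complex.conj_im]
    nlinarith [sq_nonneg ((r - s) * w.re - m * a.re), sq_nonneg ((r - s) * w.im - m * a.im)]

section RelativeEntropy

variable {n : Type*} [Fintype n] {ρ σ U V : Matrix n n ℂ} {r s : n → ℝ}

/-- Interpolation whose increment over `[0, 1]` is the quantum relative entropy of matrices with
eigenvector matrices `U`, `V` and eigenvalues `r`, `s`. -/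
noncomputable def relEntropyPrimitive (U V : Matrix n n ℂ) (r s : n → ℝ) (t : ℝ) : ℝ :=
  ∑ i, ∑ j, Complex.normSq ((Uᴴ * V) i j) * entropyPrimitive (r i) (s j) t

/-- The rate of change of `relEntropyPrimitive`, without its factor `1 - t`. -/
noncomputable def relEntropyDensity (U V : Matrix n n ℂ) (r s : n → ℝ) (t : ℝ) : ℝ :=
  ∑ i, ∑ j, Complex.normSq ((Uᴴ * V) i j) * ((r i - s j) ^ 2 / ((1 - t) * s j + t * r i))

lemma hasDerivAt_relEntropyPrimitive (hr : ∀ i, 0 ≤ r i) (hs : ∀ j, 0 ≤ s j) {t : ℝ}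
    (ht0 : 0 < t) (ht1 : t < 1) :
    HasDerivAt (relEntropyPrimitive U V r s) ((1 - t) * relEntropyDensity U V r s t) t := by
  have h : HasDerivAt (relEntropyPrimitive U V r s) (∑ i, ∑ j, Complex.normSq ((Uᴴ * V) i j) *
      ((1 - t) * (r i - s j) ^ 2 / ((1 - t) * s j + t * r i))) t :=
    HasDerivAt.fun_sum fun i _ => HasDerivAt.fun_sum fun j _ =>
      (hasDerivAt_entropyPrimitive (hr i) (hs j) ht0 ht1).const_mul _
  convert h using 1
  simp only [relEntropyDensity, Finset.mul_sum]
  refine Finset.sum_congr rfl fun i _ => Finset.sum_congr rfl fun j _ => ?_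
  ring

lemma continuousOn_relEntropyPrimitive (hr : ∀ i, 0 ≤ r i) (hs : ∀ j, 0 ≤ s j)
    (h : ∀ i j, s j = 0 → r i * Complex.normSq ((Uᴴ * V) i j) = 0) :
    ContinuousOn (relEntropyPrimitive U V r s) (Set.Icc 0 1) := by
  refine continuousOn_finsetSum _ fun i _ => continuousOn_finsetSum _ fun j _ => ?_
  by_cases hw : Complex.normSq ((Uᴴ * V) i j) = 0
  · simp only [hw, zero_mul]
    exact continuousOn_const
  · refine continuousOn_const.mul (continuousOn_entropyPrimitive (hr i) (hs j) fun h0 => ?_)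
    simpa [hw] using h i j h0

variable [DecidableEq n]

lemma relEntropyPrimitive_one_sub_zero (hρ : IsDiagonalizedBy ρ U r)
    (hσ : IsDiagonalizedBy σ V s) (htr : ρ.trace = σ.trace) :
    relEntropyPrimitive U V r s 1 - relEntropyPrimitive U V r s 0 =
      ∑ i, r i * Real.log (r i) - ∑ j, ((Vᴴ * ρ * V) j j).re * Real.log (s j) := by
  have hsum : ∑ i, r i = ∑ j, s j := by
    rw [hρ.trace_eq, hσ.trace_eq] at htr
    exact_mod_cast htr
  have hrow := IsDiagonalizedBy.sum_right_normSq hρ.conjTranspose_mul_self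
    hσ.mul_conjTranspose_self
  have hcol := IsDiagonalizedBy.sum_left_normSq hρ.mul_conjTranspose_self
    hσ.conjTranspose_mul_self
  have e1 : ∑ i, ∑ j, Complex.normSq ((Uᴴ * V) i j) * (r i * Real.log (r i) - r i) =
      ∑ i, (r i * Real.log (r i) - r i) := by
    simp only [← Finset.sum_mul, hrow, one_mul]
  have e2 : ∑ i, ∑ j, r i * Complex.normSq ((Uᴴ * V) i j) * Real.log (s j) =
      ∑ j, ((Vᴴ * ρ * V) j j).re * Real.log (s j) := by
    rw [Finset.sum_comm]
    simp only [← Finset.sum_mul, hρ.sum_mul_normSq_eq_conj_apply]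
  have e3 : ∑ i, ∑ j, Complex.normSq ((Uᴴ * V) i j) * s j = ∑ j, s j := by
    rw [Finset.sum_comm]
    simp only [← Finset.sum_mul, hcol, one_mul]
  have e4 : relEntropyPrimitive U V r s 1 - relEntropyPrimitive U V r s 0 =
      ∑ i, ∑ j, Complex.normSq ((Uᴴ * V) i j) * (r i * Real.log (r i) - r i) -
      ∑ i, ∑ j, r i * Complex.normSq ((Uᴴ * V) i j) * Real.log (s j) +
      ∑ i, ∑ j, Complex.normSq ((Uᴴ * V) i j) * s j := by
    simp only [relEntropyPrimitive, entropyPrimitive, ← Finset.sum_sub_distrib,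
      ← Finset.sum_add_distrib]
    refine Finset.sum_congr rfl fun i _ => Finset.sum_congr rfl fun j _ => ?_
    simp only [sub_self, zero_mul, one_mul, zero_add, sub_zero, add_zero, mul_one, mul_zero]
    ring
  rw [e4, e1, e2, e3, Finset.sum_sub_distrib, hsum]
  ring

lemma two_mul_trace_sub_le_relEntropyDensity (hρ : IsDiagonalizedBy ρ U r)
    (hσ : IsDiagonalizedBy σ V s) (hr : ∀ i, 0 ≤ r i) (hs : ∀ j, 0 ≤ s j) {t : ℝ}
    (ht0 : 0 < t) (ht1 : t < 1) {A : Matrix n n ℂ} (hA : A.IsHermitian) :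
    2 * ((ρ * A).trace.re - (σ * A).trace.re) -
        ((1 - t) * (σ * (A * A)).trace.re + t * (ρ * (A * A)).trace.re) ≤
      relEntropyDensity U V r s t := by
  have h1 : ∑ i, ∑ j, (r i - s j) * ((Uᴴ * V) i j * star ((Uᴴ * A * V) i j)).re =
      (ρ * A).trace.re - (σ * A).trace.re := by
    rw [← Complex.sub_re, ← hρ.sum_sub_mul_eq_trace hσ hA]
    simp only [Complex.re_sum, Complex.re_ofReal_mul]
  rw [← h1, ← hρ.sum_left_mul_normSq hσ.mul_conjTranspose_self hA,
    ← hσ.sum_right_mul_normSq hρ.mul_conjTranspose_self hA]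
  simp only [relEntropyDensity, Finset.mul_sum, ← Finset.sum_sub_distrib,
    ← Finset.sum_add_distrib]
  refine Finset.sum_le_sum fun i _ => Finset.sum_le_sum fun j _ => ?_
  refine le_trans (le_of_eq ?_) (two_mul_sub_normSq_le (hr i) (hs j) ht0 ht1 _ ((Uᴴ * A * V) i j))
  ring

lemma effect_le_relEntropyDensity (hρ : IsDiagonalizedBy ρ U r)
    (hσ : IsDiagonalizedBy σ V s) (hρ0 : ρ.PosSemidef) (hσ0 : σ.PosSemidef)
    (hr : ∀ i, 0 ≤ r i) (hs : ∀ j, 0 ≤ s j)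
    (hρ1 : ρ.trace = 1) (hσ1 : σ.trace = 1) {t : ℝ} (ht0 : 0 < t) (ht1 : t < 1)
    {F : Matrix n n ℂ} (hF : F.PosSemidef) (hF' : (1 - F).PosSemidef) (l c : ℝ) :
    2 * l * ((ρ * F).trace.re - (σ * F).trace.re) -
        l ^ 2 * ((1 - 2 * c) * ((1 - t) * (σ * F).trace.re + t * (ρ * F).trace.re) + c ^ 2) ≤
      relEntropyDensity U V r s t := by
  set A : Matrix n n ℂ := (l : ℂ) • (F - (c : ℂ) • 1) with hAdef
  have hA : A.IsHermitian := by
    rw [IsHermitian, hAdef, conjTranspose_smul, conjTranspose_sub, conjTranspose_smul, hF.1.eq]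
    simp
  have key := two_mul_trace_sub_le_relEntropyDensity hρ hσ hr hs ht0 ht1 hA
  have hτA : ∀ τ : Matrix n n ℂ, τ.trace = 1 →
      (τ * A).trace.re = l * ((τ * F).trace.re - c) := by
    intro τ hτ
    simp [hAdef, mul_sub, hτ]
  have hτAA : ∀ τ : Matrix n n ℂ, τ.PosSemidef → τ.trace = 1 →
      (τ * (A * A)).trace.re ≤ l ^ 2 * ((1 - 2 * c) * (τ * F).trace.re + c ^ 2) := by
    intro τ hτ0 hτ
    have hpos := hτ0.re_trace_mul_nonneg (hF.sub_mul_self hF')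
    have hAA : A * A = ((l ^ 2 : ℝ) : ℂ) •
        (F - (F - F * F) - ((2 * c : ℝ) : ℂ) • F + ((c ^ 2 : ℝ) : ℂ) • 1) := by
      simp only [hAdef, smul_mul_assoc, mul_smul_comm, smul_smul, sub_mul, mul_sub, one_mul,
        mul_one]
      push_cast
      module
    have e : (τ * (A * A)).trace.re = l ^ 2 * ((τ * F).trace.re - (τ * (F - F * F)).trace.re -
        2 * c * (τ * F).trace.re + c ^ 2) := by
      rw [hAA, mul_smul_comm, trace_smul, smul_eq_mul, Complex.re_ofReal_mul, mul_add, mul_sub,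
        mul_sub, mul_smul_comm, mul_smul_comm, mul_one, trace_add, trace_sub, trace_sub,
        trace_smul, trace_smul, hτ, smul_eq_mul, smul_eq_mul, mul_one]
      simp only [Complex.add_re, Complex.sub_re, Complex.re_ofReal_mul, Complex.ofReal_re]
    rw [e]
    nlinarith [mul_nonneg (sq_nonneg l) hpos]
  rw [hτA ρ hρ1, hτA σ hσ1] at key
  nlinarith [mul_le_mul_of_nonneg_left (hτAA ρ hρ0 hρ1) ht0.le,
    mul_le_mul_of_nonneg_left (hτAA σ hσ0 hσ1) (by linarith : (0 : ℝ) ≤ 1 - t)]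

end RelativeEntropy

lemma vnEntropy_mul_log_two {d : ℕ} {ρ : Matrix (Fin d) (Fin d) ℂ} (h : ρ.IsHermitian) :
    vnEntropy ρ * Real.log 2 = -∑ i, h.eigenvalues i * Real.log (h.eigenvalues i) := by
  have h2 : Real.log 2 ≠ 0 := (Real.log_pos one_lt_two).ne'
  rw [vnEntropy, dif_pos h, neg_mul, Finset.sum_mul]
  congr 1
  refine Finset.sum_congr rfl fun i _ => ?_
  rw [Real.logb, mul_assoc, div_mul_cancel₀ _ h2]

lemma binH_mul_log_two (p : ℝ) :
    binH p * Real.log 2 = -(p * Real.log p) - (1 - p) * Real.log (1 - p) := by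
  have h2 : Real.log 2 ≠ 0 := (Real.log_pos one_lt_two).ne'
  simp only [binH, Real.logb]
  field_simp

/-- Lemma 1 (lem-mix): if a two-outcome measurement `(I − E, E)` identifies the bit `b`
from `σ_b` with average probability `p`, then
`S(½(σ₀+σ₁)) ≥ ½(S(σ₀)+S(σ₁)) + (1 − H(p))`. -/
theorem entropy_increase_of_distinguishable {d : ℕ}
    (σ₀ σ₁ E : Matrix (Fin d) (Fin d) ℂ)
    (h0 : IsDensityMatrix σ₀) (h1 : IsDensityMatrix σ₁)
    (hE : E.PosSemidef) (hEle : (1 - E).PosSemidef)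
    (p : ℝ)
    (hp : ((((1 - E) * σ₀).trace).re + (((E * σ₁)).trace).re) / 2 = p) :
    vnEntropy ((1 / 2 : ℂ) • (σ₀ + σ₁)) ≥
      (vnEntropy σ₀ + vnEntropy σ₁) / 2 + (1 - binH p) := by
  obtain ⟨h0p, h0t⟩ := h0
  obtain ⟨h1p, h1t⟩ := h1
  set σ : Matrix (Fin d) (Fin d) ℂ := (1 / 2 : ℂ) • (σ₀ + σ₁) with hσ
  have hσp : σ.PosSemidef := (h0p.add h1p).smul (by norm_num [Complex.le_def])
  have hσt : σ.trace = 1 := by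
    rw [hσ, trace_smul, trace_add, h0t, h1t]
    norm_num
  have d0 := h0p.1.isDiagonalizedBy
  have d1 := h1p.1.isDiagonalizedBy
  have ds := hσp.1.isDiagonalizedBy
  set U₀ : Matrix (Fin d) (Fin d) ℂ :=
    (h0p.1.eigenvectorUnitary : Matrix (Fin d) (Fin d) ℂ)
  set U₁ : Matrix (Fin d) (Fin d) ℂ :=
    (h1p.1.eigenvectorUnitary : Matrix (Fin d) (Fin d) ℂ)
  set V : Matrix (Fin d) (Fin d) ℂ :=
    (hσp.1.eigenvectorUnitary : Matrix (Fin d) (Fin d) ℂ)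
  have r0 := h0p.eigenvalues_nonneg
  have r1 := h1p.eigenvalues_nonneg
  have rs := hσp.eigenvalues_nonneg
  have S0 := vnEntropy_mul_log_two h0p.1
  have S1 := vnEntropy_mul_log_two h1p.1
  have Sσ := vnEntropy_mul_log_two hσp.1
  set x := h0p.1.eigenvalues
  set y := h1p.1.eigenvalues
  set z := hσp.1.eigenvalues
  have hdiag : ∀ j, z j = (((Vᴴ * σ₀ * V) j j).re + ((Vᴴ * σ₁ * V) j j).re) / 2 := by
    intro j
    have e : (z j : ℂ) = (Vᴴ * σ * V) j j := by
      rw [ds.conj_eq, diagonal_apply_eq]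
    have e' : (Vᴴ * σ * V) j j =
        ((1 / 2 : ℝ) : ℂ) * ((Vᴴ * σ₀ * V) j j + (Vᴴ * σ₁ * V) j j) := by
      rw [hσ, mul_smul_comm, smul_mul_assoc, mul_add, add_mul, Matrix.smul_apply,
        Matrix.add_apply, smul_eq_mul]
      norm_num
    rw [← Complex.ofReal_re (z j), e, e', Complex.re_ofReal_mul, Complex.add_re]
    ring
  have ker0 : ∀ i j, z j = 0 → x i * Complex.normSq ((U₀ᴴ * V) i j) = 0 := by
    intro i j hj
    have a0 := d0.sum_mul_normSq_eq_conj_apply (V := V) j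
    have a1 := d1.sum_mul_normSq_eq_conj_apply (V := V) j
    have p0 : ∀ i ∈ Finset.univ, 0 ≤ x i * Complex.normSq ((U₀ᴴ * V) i j) :=
      fun i _ => mul_nonneg (r0 i) (Complex.normSq_nonneg _)
    have p1 : ∀ i ∈ Finset.univ, 0 ≤ y i * Complex.normSq ((U₁ᴴ * V) i j) :=
      fun i _ => mul_nonneg (r1 i) (Complex.normSq_nonneg _)
    have := hdiag j
    have := Finset.sum_nonneg p0
    have := Finset.sum_nonneg p1
    exact (Finset.sum_eq_zero_iff_of_nonneg p0).1 (by linarith) i (Finset.mem_univ i)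
  have ker1 : ∀ i j, z j = 0 → y i * Complex.normSq ((U₁ᴴ * V) i j) = 0 := by
    intro i j hj
    have a0 := d0.sum_mul_normSq_eq_conj_apply (V := V) j
    have a1 := d1.sum_mul_normSq_eq_conj_apply (V := V) j
    have p0 : ∀ i ∈ Finset.univ, 0 ≤ x i * Complex.normSq ((U₀ᴴ * V) i j) :=
      fun i _ => mul_nonneg (r0 i) (Complex.normSq_nonneg _)
    have p1 : ∀ i ∈ Finset.univ, 0 ≤ y i * Complex.normSq ((U₁ᴴ * V) i j) :=
      fun i _ => mul_nonneg (r1 i) (Complex.normSq_nonneg _)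
    have := hdiag j
    have := Finset.sum_nonneg p0
    have := Finset.sum_nonneg p1
    exact (Finset.sum_eq_zero_iff_of_nonneg p1).1 (by linarith) i (Finset.mem_univ i)
  have hF' : (1 - (1 - E)).PosSemidef := by rwa [sub_sub_cancel]
  set a := (σ₀ * (1 - E)).trace.re with ha
  set b := (σ₁ * E).trace.re with hb
  have hpab : p = (a + b) / 2 := by
    rw [← hp, trace_mul_comm, trace_mul_comm E]
  have ha0 : 0 ≤ a := h0p.re_trace_mul_nonneg hEle
  have hb0 : 0 ≤ b := h1p.re_trace_mul_nonneg hE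
  have hcompl : ∀ τ : Matrix (Fin d) (Fin d) ℂ, τ.trace = 1 →
      (τ * (1 - E)).trace.re = 1 - (τ * E).trace.re := by
    intro τ hτ
    rw [mul_sub, mul_one, trace_sub, hτ, Complex.sub_re, Complex.one_re]
  have ha1 : a ≤ 1 := by
    have := h0p.re_trace_mul_nonneg hE
    have := hcompl σ₀ h0t
    linarith
  have hb1 : b ≤ 1 := by
    have := h1p.re_trace_mul_nonneg hEle
    have := hcompl σ₁ h1t
    linarith
  have hp0 : 0 ≤ p := by linarith
  have hp1 : p ≤ 1 := by linarith
  have hscompl := hcompl σ hσt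
  let Φ : ℝ → ℝ := fun t =>
    (relEntropyPrimitive U₀ V x z t + relEntropyPrimitive U₁ V y z t) / 2 -
      (entropyPrimitive p (1 / 2) t + entropyPrimitive (1 - p) (1 / 2) t)
  have hcont : ContinuousOn Φ (Set.Icc 0 1) :=
    (((continuousOn_relEntropyPrimitive r0 rs ker0).add
      (continuousOn_relEntropyPrimitive r1 rs ker1)).div_const 2).sub
      ((continuousOn_entropyPrimitive hp0 (by norm_num) (by norm_num)).add
        (continuousOn_entropyPrimitive (by linarith) (by norm_num) (by norm_num)))
  have hderiv : ∀ t ∈ interior (Set.Icc (0 : ℝ) 1), 0 ≤ deriv Φ t ∧ DifferentiableAt ℝ Φ t := by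
    intro t ht
    rw [interior_Icc] at ht
    obtain ⟨t0, t1⟩ := ht
    have hd := (((hasDerivAt_relEntropyPrimitive (U := U₀) (V := V) r0 rs t0 t1).add
      (hasDerivAt_relEntropyPrimitive (U := U₁) (V := V) r1 rs t0 t1)).div_const 2).sub
      ((hasDerivAt_entropyPrimitive hp0 (by norm_num : (0 : ℝ) ≤ 1 / 2) t0 t1).add
        (hasDerivAt_entropyPrimitive (by linarith : 0 ≤ 1 - p)
          (by norm_num : (0 : ℝ) ≤ 1 / 2) t0 t1))
    have hd' : HasDerivAt Φ _ t := hd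
    refine ⟨?_, hd'.differentiableAt⟩
    rw [hd'.deriv]
    have hq : 0 < (1 - t) * (1 / 2) + t * p := by nlinarith [mul_nonneg t0.le hp0]
    have hq' : 0 < (1 - t) * (1 / 2) + t * (1 - p) := by
      nlinarith [mul_nonneg t0.le (by linarith : 0 ≤ 1 - p)]
    set q := (1 - t) * (1 / 2) + t * p with hqdef
    set q' := (1 - t) * (1 / 2) + t * (1 - p) with hqdef'
    have hqq : q' = 1 - q := by
      rw [hqdef, hqdef']
      ring
    set l := (p - 1 / 2) / (q * q') with hl
    have b0 := effect_le_relEntropyDensity d0 ds h0p hσp r0 rs h0t hσt t0 t1 hEle hF' l q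
    have b1 := effect_le_relEntropyDensity d1 ds h1p hσp r1 rs h1t hσt t0 t1 hE hEle l q
    rw [hscompl] at b0
    have hlq : l * (q * q') = p - 1 / 2 := by
      rw [hl]
      field_simp
    have hsum : 2 * (l * (p - 1 / 2)) - l * (l * (q * q')) ≤
        (relEntropyDensity U₀ V x z t + relEntropyDensity U₁ V y z t) / 2 := by
      rw [hqq]
      have e : 2 * (l * (p - 1 / 2)) - l * (l * (q * (1 - q))) =
          ((2 * l * (a - (1 - (σ * E).trace.re)) - l ^ 2 * ((1 - 2 * q) *
            ((1 - t) * (1 - (σ * E).trace.re) + t * a) + q ^ 2)) +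
          (2 * l * (b - (σ * E).trace.re) - l ^ 2 * ((1 - 2 * q) *
            ((1 - t) * (σ * E).trace.re + t * b) + q ^ 2))) / 2 := by
        have hb' : b = 2 * p - a := by linarith
        rw [hb', hqdef]
        ring
      linarith
    rw [hlq] at hsum
    have e : (1 - t) * (p - 1 / 2) ^ 2 / q + (1 - t) * (1 - p - 1 / 2) ^ 2 / q' =
        (1 - t) * (l * (p - 1 / 2)) := by
      rw [hl]
      field_simp
      rw [hqq]
      ring
    rw [e]
    nlinarith [mul_le_mul_of_nonneg_left hsum (by linarith : (0 : ℝ) ≤ 1 - t)]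
  have hmono : MonotoneOn Φ (Set.Icc 0 1) :=
    monotoneOn_of_deriv_nonneg (convex_Icc 0 1) hcont
      (fun t ht => (hderiv t ht).2.differentiableWithinAt) fun t ht => (hderiv t ht).1
  have hle := hmono (Set.left_mem_Icc.2 zero_le_one) (Set.right_mem_Icc.2 zero_le_one) zero_le_one
  have R0 := relEntropyPrimitive_one_sub_zero d0 ds (h0t.trans hσt.symm)
  have R1 := relEntropyPrimitive_one_sub_zero d1 ds (h1t.trans hσt.symm)
  have hz : ∑ j, z j * Real.log (z j) = (∑ j, ((Vᴴ * σ₀ * V) j j).re * Real.log (z j) +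
      ∑ j, ((Vᴴ * σ₁ * V) j j).re * Real.log (z j)) / 2 := by
    rw [← Finset.sum_add_distrib, Finset.sum_div]
    refine Finset.sum_congr rfl fun j _ => ?_
    nth_rewrite 1 [hdiag j]
    ring
  have hbin := binH_mul_log_two p
  have hlog : Real.log (1 / 2) = -Real.log 2 := by rw [one_div, Real.log_inv]
  simp only [Φ, entropyPrimitive, sub_self, zero_mul, one_mul, zero_add, sub_zero, add_zero,
    mul_one, mul_zero, hlog] at hle
  have hl2 : 0 < Real.log 2 := Real.log_pos one_lt_two
  refine le_of_mul_le_mul_right ?_ hl2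
  linarith
end

section
/- Holevo's theorem (Theorem 5, finite-dimensional, finite-outcome form): Let α and β be finite nonempty types, let (p_x)_{x∈α} be a probability distribution (p_x ≥ 0, Σ_x p_x = 1), let (σ_x)_{x∈α} be density matrices on ℂ^d, and let σ = Σ_x p_x σ_x. Let (E_y)_{y∈β} be a POVM on ℂ^d, i.e., each E_y is positive semidefinite and Σ_y E_y = I. Define the joint distribution P(x,y) = p_x · Tr(E_y σ_x), with marginals p_x = Σ_y P(x,y) and q_y = Σ_x P(x,y). Then the mutual information I(X:Y) = Σ_{x,y} P(x,y) log₂( P(x,y) / (p_x q_y) ) (terms with P(x,y) = 0 contributing 0) satisfies I(X:Y) ≤ S(σ) − Σ_x p_x S(σ_x). -/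
open Matrix
open scoped ComplexOrder

/-- The antiderivative in `t` of `t * (m - l) ^ 2 / ((1 - t) * l + t * m)` whose increment over
`[0, 1]` is `l * log (l / m) - l + m`. -/
noncomputable def divergencePath (l m t : ℝ) : ℝ :=
  t * (m - l) - l * Real.log ((1 - t) * l + t * m)

lemma hasDerivAt_divergencePath {l m t : ℝ} (hl : 0 ≤ l) (hm : 0 ≤ m) (ht : t ∈ Set.Ioo 0 1) :
    HasDerivAt (divergencePath l m) (t * ((m - l) ^ 2 / ((1 - t) * l + t * m))) t := by
  obtain ⟨h0, h1⟩ := ht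
  unfold divergencePath
  have hid : HasDerivAt (fun t : ℝ => t * (m - l)) (m - l) t := by
    simpa using (hasDerivAt_id t).mul_const (m - l)
  rcases hl.eq_or_lt with rfl | hl
  · rcases hm.eq_or_lt with rfl | hm
    · simpa using hid
    · convert hid using 1
      · ext; simp
      · field_simp
        simp
  · have hpos : 0 < (1 - t) * l + t * m := by
      have : 0 < (1 - t) * l := mul_pos (by linarith) hl
      positivity
    have harg : HasDerivAt (fun t : ℝ => (1 - t) * l + t * m) (m - l) t := by
      refine ((((hasDerivAt_id' t).const_sub 1).mul_const l).fun_add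
        ((hasDerivAt_id' t).mul_const m)).congr_deriv ?_
      ring
    refine (hid.fun_sub ((harg.log hpos.ne').const_mul l)).congr_deriv ?_
    field_simp
    ring

lemma continuousOn_divergencePath {l m : ℝ} (hl : 0 ≤ l) (hm : 0 ≤ m) (h : m = 0 → l = 0) :
    ContinuousOn (divergencePath l m) (Set.Icc 0 1) := by
  unfold divergencePath
  rcases hl.eq_or_lt with rfl | hl
  · simp only [zero_mul, sub_zero]
    fun_prop
  · have hm : 0 < m := hm.lt_of_ne' fun h0 => hl.ne' (h h0)
    refine ContinuousOn.sub (by fun_prop)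
      (continuousOn_const.mul (ContinuousOn.log (by fun_prop) ?_))
    rintro t ⟨h0, h1⟩
    rcases h0.eq_or_lt with rfl | h0
    · simpa using hl.ne'
    · have : 0 ≤ (1 - t) * l := mul_nonneg (by linarith) hl.le
      positivity

lemma divergencePath_one_sub_zero (l m : ℝ) :
    divergencePath l m 1 - divergencePath l m 0 =
      (m - l) + (l * Real.log l - l * Real.log m) := by
  simp [divergencePath]
  ring

/-- A comparison of (weighted) quadratic divergences along the segment between two families
integrates to a comparison of (weighted) relative entropies. -/
lemma sum_divergence_le {ι κ : Type*} [Fintype ι] [Fintype κ] (a l m : ι → ℝ) (p q : κ → ℝ)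
    (hl : ∀ i, 0 ≤ l i) (hm : ∀ i, 0 ≤ m i) (hp : ∀ k, 0 ≤ p k) (hq : ∀ k, 0 ≤ q k)
    (hlm : ∀ i, m i = 0 → a i * l i = 0) (hpq : ∀ k, q k = 0 → p k = 0)
    (h : ∀ t ∈ Set.Ioo (0 : ℝ) 1, ∑ k, (q k - p k) ^ 2 / ((1 - t) * p k + t * q k) ≤
      ∑ i, a i * ((m i - l i) ^ 2 / ((1 - t) * l i + t * m i))) :
    ∑ k, ((q k - p k) + (p k * Real.log (p k) - p k * Real.log (q k))) ≤
      ∑ i, a i * ((m i - l i) + (l i * Real.log (l i) - l i * Real.log (m i))) := by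
  let F : ℝ → ℝ := fun t => ∑ i, a i * divergencePath (l i) (m i) t
    - ∑ k, divergencePath (p k) (q k) t
  have hcont : ContinuousOn F (Set.Icc 0 1) := by
    refine (continuousOn_finsetSum _ fun i _ => ?_).sub (continuousOn_finsetSum _ fun k _ =>
      continuousOn_divergencePath (hp k) (hq k) (hpq k))
    by_cases ha : a i = 0
    · simpa [ha] using continuousOn_const
    · exact continuousOn_const.mul (continuousOn_divergencePath (hl i) (hm i) fun h0 =>
        (mul_eq_zero.mp (hlm i h0)).resolve_left ha)
  have hderiv : ∀ t ∈ Set.Ioo (0 : ℝ) 1, HasDerivAt F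
      (∑ i, a i * (t * ((m i - l i) ^ 2 / ((1 - t) * l i + t * m i)))
        - ∑ k, t * ((q k - p k) ^ 2 / ((1 - t) * p k + t * q k))) t := fun t ht =>
    (HasDerivAt.fun_sum fun i _ =>
      (hasDerivAt_divergencePath (hl i) (hm i) ht).const_mul (a i)).sub
    (HasDerivAt.fun_sum fun k _ => hasDerivAt_divergencePath (hp k) (hq k) ht)
  have hmono : MonotoneOn F (Set.Icc 0 1) := by
    refine monotoneOn_of_deriv_nonneg (convex_Icc 0 1) hcont ?_ ?_ <;> rw [interior_Icc]
    · exact fun t ht => (hderiv t ht).differentiableAt.differentiableWithinAt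
    · intro t ht
      rw [(hderiv t ht).deriv]
      simp only [mul_left_comm _ t, ← Finset.mul_sum, ← mul_sub]
      exact mul_nonneg ht.1.le (sub_nonneg.mpr (h t ht))
  have h01 : F 0 ≤ F 1 := hmono (by simp) (by simp) zero_le_one
  simp only [← divergencePath_one_sub_zero, mul_sub, Finset.sum_sub_distrib]
  simp only [F] at h01
  linarith

lemma sq_div_eq_quadratic (p q t : ℝ) :
    (q - p) ^ 2 / ((1 - t) * p + t * q) =
      2 * ((q - p) / ((1 - t) * p + t * q)) * (q - p)
        - ((q - p) / ((1 - t) * p + t * q)) ^ 2 * ((1 - t) * p + t * q) := by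
  by_cases h : (1 - t) * p + t * q = 0
  · simp [h]
  · field_simp
    ring

lemma quadratic_le_normSq_mul_div {l m t : ℝ} (hl : 0 ≤ l) (hm : 0 ≤ m)
    (ht : t ∈ Set.Ioo 0 1) (x w : ℂ) :
    2 * ((m - l) * (x * star w).re) - ((1 - t) * l + t * m) * Complex.normSq x ≤
      Complex.normSq w * ((m - l) ^ 2 / ((1 - t) * l + t * m)) := by
  obtain ⟨h0, h1⟩ := ht
  have hl' : 0 ≤ (1 - t) * l := mul_nonneg (by linarith) hl
  have hm' : 0 ≤ t * m := by positivity
  rcases (add_nonneg hl' hm').eq_or_lt with h | h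
  · have e1 : (1 - t) * l = 0 := by linarith
    have e2 : t * m = 0 := by linarith
    have e3 : l = 0 := (mul_eq_zero.mp e1).resolve_left (by linarith)
    have e4 : m = 0 := (mul_eq_zero.mp e2).resolve_left (by linarith)
    simp [e3, e4]
  · rw [mul_div_assoc', le_div_iff₀ h]
    set s := (1 - t) * l + t * m
    simp only [Complex.normSq_apply, Complex.mul_re, Complex.star_def, Complex.conj_re,
      Complex.conj_im]
    nlinarith [sq_nonneg (s * x.re - (m - l) * w.re), sq_nonneg (s * x.im - (m - l) * w.im)]

lemma re_mul_star_self (z : ℂ) : (z * star z).re = Complex.normSq z := by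
  rw [Complex.star_def, Complex.mul_conj, Complex.ofReal_re]

namespace Matrix

variable {n : Type*} [Fintype n] [DecidableEq n]

/-- The trace against a Hermitian matrix, computed in its eigenbasis. -/
lemma IsHermitian.trace_mul_eq_sum {ρ : Matrix n n ℂ} (hρ : ρ.IsHermitian) (Y : Matrix n n ℂ) :
    (Y * ρ).trace = ∑ i, (hρ.eigenvalues i : ℂ) *
      (star (hρ.eigenvectorUnitary : Matrix n n ℂ) * Y * hρ.eigenvectorUnitary) i i := by
  conv_lhs => rw [hρ.spectral_theorem, Unitary.conjStarAlgAut_apply]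
  rw [← mul_assoc, trace_mul_comm, ← mul_assoc, ← mul_assoc, trace]
  simp [mul_diagonal, mul_comm]

lemma PosSemidef.re_trace_mul_nonneg_s2 {A B : Matrix n n ℂ} (hA : A.PosSemidef)
    (hB : B.PosSemidef) : 0 ≤ (A * B).trace.re := by
  rw [hB.1.trace_mul_eq_sum, Complex.re_sum]
  refine Finset.sum_nonneg fun i _ => ?_
  rw [Complex.re_ofReal_mul]
  exact mul_nonneg (hB.eigenvalues_nonneg i)
    (Complex.nonneg_iff.mp (hA.conjTranspose_mul_mul_same _).diag_nonneg).1

section Overlap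

variable {ρ τ : Matrix n n ℂ}

/-- The matrix `X` with rows in the eigenbasis of `ρ` and columns in the eigenbasis of `τ`. -/
noncomputable def mixedBasis (hρ : ρ.IsHermitian) (hτ : τ.IsHermitian) (X : Matrix n n ℂ) :
    Matrix n n ℂ :=
  star (hρ.eigenvectorUnitary : Matrix n n ℂ) * X * hτ.eigenvectorUnitary

variable (hρ : ρ.IsHermitian) (hτ : τ.IsHermitian)

lemma re_trace_mul_left (X Y : Matrix n n ℂ) :
    ((X * Yᴴ) * ρ).trace.re = ∑ i, ∑ j, hρ.eigenvalues i *
      (mixedBasis hρ hτ X i j * star (mixedBasis hρ hτ Y i j)).re := by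
  have h : star (hρ.eigenvectorUnitary : Matrix n n ℂ) * (X * Yᴴ) * hρ.eigenvectorUnitary
      = mixedBasis hρ hτ X * (mixedBasis hρ hτ Y)ᴴ := by
    have hV : (hτ.eigenvectorUnitary : Matrix n n ℂ) *
        (hτ.eigenvectorUnitary : Matrix n n ℂ)ᴴ = 1 := Unitary.coe_mul_star_self _
    simp only [mixedBasis, conjTranspose_mul, star_eq_conjTranspose, conjTranspose_conjTranspose,
      mul_assoc]
    rw [← mul_assoc (hτ.eigenvectorUnitary : Matrix n n ℂ), hV, one_mul]
  rw [hρ.trace_mul_eq_sum, h, Complex.re_sum]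
  refine Finset.sum_congr rfl fun i _ => ?_
  rw [Complex.re_ofReal_mul, mul_apply, Complex.re_sum, Finset.mul_sum]
  simp only [conjTranspose_apply]

lemma re_trace_mul_right (X Y : Matrix n n ℂ) :
    ((Yᴴ * X) * τ).trace.re = ∑ i, ∑ j, hτ.eigenvalues j *
      (mixedBasis hρ hτ X i j * star (mixedBasis hρ hτ Y i j)).re := by
  have h : star (hτ.eigenvectorUnitary : Matrix n n ℂ) * (Yᴴ * X) * hτ.eigenvectorUnitary
      = (mixedBasis hρ hτ Y)ᴴ * mixedBasis hρ hτ X := by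
    have hU : (hρ.eigenvectorUnitary : Matrix n n ℂ) *
        (hρ.eigenvectorUnitary : Matrix n n ℂ)ᴴ = 1 := Unitary.coe_mul_star_self _
    simp only [mixedBasis, conjTranspose_mul, star_eq_conjTranspose, conjTranspose_conjTranspose,
      mul_assoc]
    rw [← mul_assoc (hρ.eigenvectorUnitary : Matrix n n ℂ), hU, one_mul]
  rw [hτ.trace_mul_eq_sum, h, Complex.re_sum, Finset.sum_comm]
  refine Finset.sum_congr rfl fun j _ => ?_
  rw [Complex.re_ofReal_mul, mul_apply, Complex.re_sum, Finset.mul_sum]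
  simp only [conjTranspose_apply, mul_comm]

lemma sum_normSq_overlap_mul_left (f : n → ℝ) :
    ∑ i, ∑ j, Complex.normSq (mixedBasis hρ hτ 1 i j) * f i = ∑ i, f i := by
  have h : mixedBasis hρ hτ 1 * (mixedBasis hρ hτ 1)ᴴ = 1 := by
    have hU : (hρ.eigenvectorUnitary : Matrix n n ℂ)ᴴ *
        (hρ.eigenvectorUnitary : Matrix n n ℂ) = 1 := Unitary.coe_star_mul_self _
    have hV : (hτ.eigenvectorUnitary : Matrix n n ℂ) *
        (hτ.eigenvectorUnitary : Matrix n n ℂ)ᴴ = 1 := Unitary.coe_mul_star_self _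
    simp only [mixedBasis, conjTranspose_mul, star_eq_conjTranspose, conjTranspose_conjTranspose,
      mul_assoc, mul_one]
    rw [← mul_assoc (hτ.eigenvectorUnitary : Matrix n n ℂ), hV, one_mul, hU]
  refine Finset.sum_congr rfl fun i _ => ?_
  have hi := congrArg Complex.re (congrFun (congrFun h i) i)
  simp only [mul_apply, conjTranspose_apply, Complex.re_sum, Complex.star_def, Complex.mul_conj,
    Complex.ofReal_re, one_apply_eq, Complex.one_re] at hi
  rw [← Finset.sum_mul, hi, one_mul]

lemma re_conj_eigenvectorUnitary_apply_self (j : n) :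
    ((star (hτ.eigenvectorUnitary : Matrix n n ℂ) * ρ * hτ.eigenvectorUnitary) j j).re =
      ∑ i, Complex.normSq (mixedBasis hρ hτ 1 i j) * hρ.eigenvalues i := by
  have h : star (hτ.eigenvectorUnitary : Matrix n n ℂ) * ρ *
      (hτ.eigenvectorUnitary : Matrix n n ℂ) =
      (mixedBasis hρ hτ 1)ᴴ * diagonal (RCLike.ofReal ∘ hρ.eigenvalues) * mixedBasis hρ hτ 1 := by
    conv_lhs => rw [hρ.spectral_theorem, Unitary.conjStarAlgAut_apply]
    simp only [mixedBasis, conjTranspose_mul, star_eq_conjTranspose, conjTranspose_conjTranspose,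
      mul_assoc, mul_one]
  rw [h, mul_apply, Complex.re_sum]
  refine Finset.sum_congr rfl fun i _ => ?_
  rw [mul_diagonal, conjTranspose_apply, ← re_mul_star_self, mul_comm _ (hρ.eigenvalues i),
    ← Complex.re_ofReal_mul]
  congr 1
  simp only [Function.comp_apply, Complex.coe_algebraMap]
  ring

lemma conj_eigenvectorUnitary_apply_self (j : n) :
    (star (hτ.eigenvectorUnitary : Matrix n n ℂ) * τ * hτ.eigenvectorUnitary) j j =
      hτ.eigenvalues j := by
  have h := hτ.conjStarAlgAut_star_eigenvectorUnitary
  rw [Unitary.conjStarAlgAut_star_apply] at h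
  rw [h, diagonal_apply_eq]
  rfl

end Overlap

/-- Operator Jensen inequality for the square and a positive operator-valued measure. -/
lemma posSemidef_sum_sq_smul_sub_sq {β : Type*} [Fintype β] {E : β → Matrix n n ℂ}
    (hE : ∀ y, (E y).PosSemidef) (hEsum : ∑ y, E y = 1) (c : β → ℝ) :
    (∑ y, ((c y ^ 2 : ℝ) : ℂ) • E y
      - (∑ y, (c y : ℂ) • E y) * (∑ y, (c y : ℂ) • E y)).PosSemidef := by
  set X := ∑ y, (c y : ℂ) • E y with hX
  have hXH : Xᴴ = X := by
    simp [hX, conjTranspose_sum, conjTranspose_smul, (hE _).1.eq]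
  have key : ∑ y, ((c y : ℂ) • (1 : Matrix n n ℂ) - X)ᴴ * E y * ((c y : ℂ) • 1 - X)
      = ∑ y, ((c y ^ 2 : ℝ) : ℂ) • E y - X * X := by
    have : ∀ y, ((c y : ℂ) • (1 : Matrix n n ℂ) - X)ᴴ * E y * ((c y : ℂ) • 1 - X)
        = ((c y ^ 2 : ℝ) : ℂ) • E y - ((c y : ℂ) • E y) * X - X * ((c y : ℂ) • E y)
          + X * E y * X := by
      intro y
      simp only [conjTranspose_sub, conjTranspose_smul, conjTranspose_one, hXH, Complex.star_def,
        Complex.conj_ofReal, sub_mul, mul_sub, smul_mul_assoc, mul_smul_comm, one_mul, mul_one]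
      push_cast
      module
    rw [Finset.sum_congr rfl fun y _ => this y]
    simp only [Finset.sum_add_distrib, Finset.sum_sub_distrib, ← Finset.sum_mul, ← Finset.mul_sum,
      ← hX, hEsum, mul_one]
    abel
  rw [← key]
  exact posSemidef_sum _ fun y _ => (hE y).conjTranspose_mul_mul_same _

section Measurement

variable {β : Type*} [Fintype β] {ρ τ : Matrix n n ℂ} {E : β → Matrix n n ℂ}

lemma re_trace_sum_smul_mul (c : β → ℝ) (R : Matrix n n ℂ) :
    ((∑ y, (c y : ℂ) • E y) * R).trace.re = ∑ y, c y * (E y * R).trace.re := by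
  simp [Finset.sum_mul, trace_sum, Complex.re_sum]

/-- Monotonicity under a measurement of the quadratic divergences along a segment. -/
lemma sum_sq_div_re_trace_le (hρ : ρ.PosSemidef) (hτ : τ.PosSemidef)
    (hE : ∀ y, (E y).PosSemidef) (hEsum : ∑ y, E y = 1) {t : ℝ} (ht : t ∈ Set.Ioo 0 1) :
    ∑ y, ((E y * τ).trace.re - (E y * ρ).trace.re) ^ 2 /
        ((1 - t) * (E y * ρ).trace.re + t * (E y * τ).trace.re) ≤
      ∑ ij : n × n, Complex.normSq (mixedBasis hρ.1 hτ.1 1 ij.1 ij.2) *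
        ((hτ.1.eigenvalues ij.2 - hρ.1.eigenvalues ij.1) ^ 2 /
          ((1 - t) * hρ.1.eigenvalues ij.1 + t * hτ.1.eigenvalues ij.2)) := by
  obtain ⟨c, hc⟩ : ∃ c : β → ℝ, c = fun y => ((E y * τ).trace.re - (E y * ρ).trace.re) /
    ((1 - t) * (E y * ρ).trace.re + t * (E y * τ).trace.re) := ⟨_, rfl⟩
  set X := ∑ y, (c y : ℂ) • E y with hX
  have hXH : Xᴴ = X := by
    simp [hX, conjTranspose_sum, conjTranspose_smul, (hE _).1.eq]
  have hjensen : ∀ R : Matrix n n ℂ, R.PosSemidef →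
      (X * X * R).trace.re ≤ ∑ y, c y ^ 2 * (E y * R).trace.re := by
    intro R hR
    have h := (posSemidef_sum_sq_smul_sub_sq hE hEsum c).re_trace_mul_nonneg_s2 hR
    rw [sub_mul, trace_sub, Complex.sub_re, re_trace_sum_smul_mul] at h
    linarith
  have h1ρ := re_trace_mul_left hρ.1 hτ.1 X 1
  have h1τ := re_trace_mul_right hρ.1 hτ.1 X 1
  have h2ρ := re_trace_mul_left hρ.1 hτ.1 X X
  have h2τ := re_trace_mul_right hρ.1 hτ.1 X X
  rw [conjTranspose_one, mul_one, re_trace_sum_smul_mul] at h1ρ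
  rw [conjTranspose_one, one_mul, re_trace_sum_smul_mul] at h1τ
  rw [hXH] at h2ρ h2τ
  calc _ = 2 * (∑ y, c y * (E y * τ).trace.re - ∑ y, c y * (E y * ρ).trace.re)
        - ((1 - t) * ∑ y, c y ^ 2 * (E y * ρ).trace.re
          + t * ∑ y, c y ^ 2 * (E y * τ).trace.re) := by
        simp only [Finset.mul_sum, ← Finset.sum_sub_distrib, ← Finset.sum_add_distrib]
        refine Finset.sum_congr rfl fun y _ => ?_
        rw [sq_div_eq_quadratic, hc]
        ring
    _ ≤ 2 * (∑ y, c y * (E y * τ).trace.re - ∑ y, c y * (E y * ρ).trace.re)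
        - ((1 - t) * (X * X * ρ).trace.re + t * (X * X * τ).trace.re) := by
        have := mul_le_mul_of_nonneg_left (hjensen ρ hρ) (sub_nonneg.mpr ht.2.le)
        have := mul_le_mul_of_nonneg_left (hjensen τ hτ) ht.1.le
        linarith
    _ ≤ _ := by
        rw [h1ρ, h1τ, h2ρ, h2τ, Fintype.sum_prod_type]
        simp only [Finset.mul_sum, ← Finset.sum_sub_distrib, ← Finset.sum_add_distrib]
        refine Finset.sum_le_sum fun i _ => Finset.sum_le_sum fun j _ => ?_
        refine le_trans (le_of_eq ?_) (quadratic_le_normSq_mul_div (hρ.eigenvalues_nonneg i)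
          (hτ.eigenvalues_nonneg j) ht (mixedBasis hρ.1 hτ.1 X i j) _)
        rw [re_mul_star_self (mixedBasis hρ.1 hτ.1 X i j)]
        ring

/-- The relative entropy of `ρ` with respect to `τ` (in nats) does not increase under a
measurement. -/
lemma sum_measured_le_relEntropy (hρ : ρ.PosSemidef) (hτ : τ.PosSemidef)
    {C : ℝ} (hC : ((C : ℂ) • τ - ρ).PosSemidef)
    (hE : ∀ y, (E y).PosSemidef) (hEsum : ∑ y, E y = 1) :
    ∑ y, (E y * ρ).trace.re *
        (Real.log (E y * ρ).trace.re - Real.log (E y * τ).trace.re) ≤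
      ∑ i, hρ.1.eigenvalues i * Real.log (hρ.1.eigenvalues i) -
        ∑ j, Real.log (hτ.1.eigenvalues j) *
          ((star (hτ.1.eigenvectorUnitary : Matrix n n ℂ) * ρ
            * hτ.1.eigenvectorUnitary) j j).re := by
  have hdiag := re_conj_eigenvectorUnitary_apply_self hρ.1 hτ.1
  have hsum : ∀ R : Matrix n n ℂ, ∑ y, (E y * R).trace.re = R.trace.re := fun R => by
    rw [← Complex.re_sum, ← trace_sum, ← Finset.sum_mul, hEsum, one_mul]
  have htrρ := re_trace_mul_left hρ.1 hτ.1 1 1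
  have htrτ := re_trace_mul_right hρ.1 hτ.1 1 1
  simp only [conjTranspose_one, one_mul, re_mul_star_self] at htrρ htrτ
  have hker : ∀ ij : n × n, hτ.1.eigenvalues ij.2 = 0 →
      Complex.normSq (mixedBasis hρ.1 hτ.1 1 ij.1 ij.2) * hρ.1.eigenvalues ij.1 = 0 := by
    rintro ⟨i, j⟩ hj
    have h := (Complex.nonneg_iff.mp ((hC.conjTranspose_mul_mul_same
      (hτ.1.eigenvectorUnitary : Matrix n n ℂ)).diag_nonneg (i := j))).1
    rw [← star_eq_conjTranspose, mul_sub, sub_mul, sub_apply, mul_smul_comm, smul_mul_assoc,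
      smul_apply, conj_eigenvectorUnitary_apply_self, hj, Complex.sub_re, hdiag] at h
    have hnonneg : ∀ i ∈ Finset.univ, 0 ≤ Complex.normSq (mixedBasis hρ.1 hτ.1 1 i j) *
        hρ.1.eigenvalues i := fun i _ =>
      mul_nonneg (Complex.normSq_nonneg _) (hρ.eigenvalues_nonneg i)
    refine (Finset.sum_eq_zero_iff_of_nonneg hnonneg).mp ?_ i (Finset.mem_univ i)
    refine le_antisymm ?_ (Finset.sum_nonneg hnonneg)
    simpa using h
  have hac : ∀ y, (E y * τ).trace.re = 0 → (E y * ρ).trace.re = 0 := by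
    intro y hy
    have h := (hE y).re_trace_mul_nonneg_s2 hC
    rw [mul_sub, trace_sub, Complex.sub_re, mul_smul_comm, trace_smul, smul_eq_mul,
      Complex.re_ofReal_mul, hy] at h
    linarith [(hE y).re_trace_mul_nonneg_s2 hρ]
  have main := sum_divergence_le
    (fun ij : n × n => Complex.normSq (mixedBasis hρ.1 hτ.1 1 ij.1 ij.2))
    (fun ij => hρ.1.eigenvalues ij.1) (fun ij => hτ.1.eigenvalues ij.2)
    (fun y => (E y * ρ).trace.re) (fun y => (E y * τ).trace.re)
    (fun _ => hρ.eigenvalues_nonneg _) (fun _ => hτ.eigenvalues_nonneg _)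
    (fun y => (hE y).re_trace_mul_nonneg_s2 hρ) (fun y => (hE y).re_trace_mul_nonneg_s2 hτ)
    hker hac (fun t ht => sum_sq_div_re_trace_le hρ hτ hE hEsum ht)
  have hcross : ∑ i, ∑ j, Complex.normSq (mixedBasis hρ.1 hτ.1 1 i j) *
      (hρ.1.eigenvalues i * Real.log (hτ.1.eigenvalues j)) =
      ∑ j, Real.log (hτ.1.eigenvalues j) *
          ((star (hτ.1.eigenvectorUnitary : Matrix n n ℂ) * ρ
            * hτ.1.eigenvectorUnitary) j j).re := by
    rw [Finset.sum_comm]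
    refine Finset.sum_congr rfl fun j _ => ?_
    rw [hdiag, Finset.mul_sum]
    exact Finset.sum_congr rfl fun i _ => by ring
  have hself := sum_normSq_overlap_mul_left hρ.1 hτ.1
    fun i => hρ.1.eigenvalues i * Real.log (hρ.1.eigenvalues i)
  simp only [Finset.sum_add_distrib, Finset.sum_sub_distrib, hsum, Fintype.sum_prod_type, mul_add,
    mul_sub, hcross, hself] at main ⊢
  simp only [mul_comm (Complex.normSq _) (hρ.1.eigenvalues _),
    mul_comm (Complex.normSq _) (hτ.1.eigenvalues _), ← htrρ, ← htrτ] at main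
  linarith

end Measurement

end Matrix

/-- The entropy form of the measured relative entropy bound for one member of an ensemble. -/
lemma mul_measured_logb_le {d : ℕ} {β : Type*} [Fintype β] {ρ τ : Matrix (Fin d) (Fin d) ℂ}
    (hρ : ρ.PosSemidef) (hτ : τ.PosSemidef) {r : ℝ} (hr : 0 ≤ r)
    (hle : (τ - (r : ℂ) • ρ).PosSemidef) {E : β → Matrix (Fin d) (Fin d) ℂ}
    (hE : ∀ y, (E y).PosSemidef) (hEsum : ∑ y, E y = 1) :
    ∑ y, r * (E y * ρ).trace.re *
        Real.logb 2 (r * (E y * ρ).trace.re / (r * (E y * τ).trace.re)) ≤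
      -(∑ j, Real.logb 2 (hτ.1.eigenvalues j) *
          ((star (hτ.1.eigenvectorUnitary : Matrix (Fin d) (Fin d) ℂ) * ((r : ℂ) • ρ)
            * hτ.1.eigenvectorUnitary) j j).re) - r * vnEntropy ρ := by
  rcases hr.eq_or_lt with rfl | hr
  · simp
  have hr' : (r : ℂ) ≠ 0 := by exact_mod_cast hr.ne'
  have hC : (((r⁻¹ : ℝ) : ℂ) • τ - ρ).PosSemidef := by
    have h := hle.smul (Complex.zero_le_real.mpr (inv_nonneg.mpr hr.le))
    rwa [smul_sub, smul_smul, Complex.ofReal_inv, inv_mul_cancel₀ hr', one_smul,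
      ← Complex.ofReal_inv] at h
  have h := sum_measured_le_relEntropy hρ hτ hC hE hEsum
  have h2 : 0 < Real.log 2 := Real.log_pos one_lt_two
  have hterm : ∀ y, r * (E y * ρ).trace.re *
      Real.logb 2 (r * (E y * ρ).trace.re / (r * (E y * τ).trace.re)) =
      r / Real.log 2 * ((E y * ρ).trace.re *
        (Real.log (E y * ρ).trace.re - Real.log (E y * τ).trace.re)) := by
    intro y
    by_cases hy : (E y * ρ).trace.re = 0
    · simp [hy]
    · have hy' : (E y * τ).trace.re ≠ 0 := by
        intro h0
        have h := (hE y).re_trace_mul_nonneg_s2 hC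
        rw [mul_sub, trace_sub, Complex.sub_re, mul_smul_comm, trace_smul, smul_eq_mul,
          Complex.re_ofReal_mul, h0] at h
        exact hy (le_antisymm (by linarith) ((hE y).re_trace_mul_nonneg_s2 hρ))
      rw [mul_div_mul_left _ _ hr.ne', Real.logb, Real.log_div hy hy']
      ring
  rw [Finset.sum_congr rfl fun y _ => hterm y, ← Finset.mul_sum, vnEntropy, dif_pos hρ.1]
  refine (mul_le_mul_of_nonneg_left h (div_pos hr h2).le).trans_eq ?_
  simp only [mul_smul_comm, smul_mul_assoc, Matrix.smul_apply, smul_eq_mul, Complex.re_ofReal_mul,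
    Real.logb, mul_neg, mul_sub, Finset.mul_sum, sub_neg_eq_add]
  rw [sub_eq_neg_add]
  congr 1
  · rw [neg_inj]
    exact Finset.sum_congr rfl fun j _ => by ring
  · exact Finset.sum_congr rfl fun j _ => by ring

/-- Theorem 5 (Holevo's theorem, finite-dimensional, finite-outcome form):
for a quantum encoding `x ↦ σ x` of a random variable `X` with distribution `p`,
and a POVM `(E y)` producing the outcome `Y`, the mutual information satisfies
`I(X:Y) ≤ S(σ) − Σ_x p_x S(σ_x)` where `σ = Σ_x p_x σ_x`. -/
theorem holevo {d : ℕ} {α β : Type*} [Fintype α] [Fintype β] [Nonempty α] [Nonempty β]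
    (p : α → ℝ) (hp : ∀ x, 0 ≤ p x) (hps : ∑ x, p x = 1)
    (σ : α → Matrix (Fin d) (Fin d) ℂ) (hσ : ∀ x, IsDensityMatrix (σ x))
    (E : β → Matrix (Fin d) (Fin d) ℂ) (hE : ∀ y, (E y).PosSemidef)
    (hEsum : ∑ y, E y = 1)
    (P : α → β → ℝ) (hP : ∀ x y, P x y = p x * ((E y * σ x).trace).re)
    (q : β → ℝ) (hq : ∀ y, q y = ∑ x, P x y) :
    ∑ x, ∑ y, P x y * Real.logb 2 (P x y / (p x * q y)) ≤
      vnEntropy (∑ x, (p x : ℂ) • σ x) - ∑ x, p x * vnEntropy (σ x) := by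
  have hpσ : ∀ x, ((p x : ℂ) • σ x).PosSemidef := fun x =>
    (hσ x).1.smul (Complex.zero_le_real.mpr (hp x))
  set τ := ∑ x, (p x : ℂ) • σ x with hτ_def
  have hτ : τ.PosSemidef := posSemidef_sum _ fun x _ => hpσ x
  have hle : ∀ x, (τ - (p x : ℂ) • σ x).PosSemidef := fun x => by
    classical
    rw [hτ_def, ← Finset.sum_erase_eq_sub (Finset.mem_univ x)]
    exact posSemidef_sum _ fun x _ => hpσ x
  have hqτ : ∀ y, q y = (E y * τ).trace.re := fun y => by
    rw [hq, hτ_def, Finset.mul_sum, trace_sum, Complex.re_sum]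
    refine Finset.sum_congr rfl fun x _ => ?_
    rw [hP, mul_smul_comm, trace_smul, smul_eq_mul, Complex.re_ofReal_mul]
  simp only [hP, hqτ]
  refine (Finset.sum_le_sum fun x _ =>
    mul_measured_logb_le (hσ x).1 hτ (hp x) (hle x) hE hEsum).trans_eq ?_
  rw [Finset.sum_sub_distrib, Finset.sum_neg_distrib, Finset.sum_comm]
  congr 1
  rw [vnEntropy, dif_pos hτ.1, neg_inj]
  refine Finset.sum_congr rfl fun j _ => ?_
  rw [← Finset.mul_sum, ← Complex.re_sum, ← Matrix.sum_apply, ← Finset.sum_mul, ← Finset.mul_sum,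
    ← hτ_def, conj_eigenvectorUnitary_apply_self, Complex.ofReal_re, mul_comm]
end

section
/- Theorem 3 (lower bound for random access and serial quantum codes): Let n, m be natural numbers and 1/2 ≤ p ≤ 1. Suppose f maps each string x ∈ {0,1}^n to a density matrix f(x) on ℂ^{2^m}, and for each index i ∈ {1,…,n} and each suffix s = x_{i+1}⋯x_n ∈ {0,1}^{n−i} there is a matrix E_{i,s} on ℂ^{2^m} that is positive semidefinite with E_{i,s} ≤ I, such that for every x ∈ {0,1}^n: Tr(E_{i,s} f(x)) ≥ p if x_i = 1, and Tr((I − E_{i,s}) f(x)) ≥ p if x_i = 0, where s is the suffix x_{i+1}⋯x_n of x. Then m ≥ (1 − H(p))·n. -/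
open Matrix
open scoped ComplexOrder

/-- The suffix `x_{i+1} ⋯ x_n` (of length `n − 1 − i` in 0-indexed terms) of a
string `x ∈ {0,1}^n` after position `i`. -/
def suffixAfter {n : ℕ} (x : Fin n → Bool) (i : Fin n) : Fin (n - 1 - i.val) → Bool :=
  fun j => x ⟨i.val + 1 + j.val, by have := j.isLt; have := i.isLt; omega⟩

lemma hasDerivAt_mul_log_add_mul {w l u t : ℝ} (hl : 0 ≤ l) (h : w * l = 0 ∨ 0 < u)
    (ht : 0 ≤ t) :
    HasDerivAt (fun t => w * l * (Real.log (u + t * l) - Real.log u))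
      (w * (l ^ 2 / (u + t * l))) t := by
  rcases h with h | h
  · have : w * (l ^ 2 / (u + t * l)) = 0 := by
      rw [show w * (l ^ 2 / (u + t * l)) = (w * l) * (l / (u + t * l)) by ring, h, zero_mul]
    simp only [this, h, zero_mul]
    exact hasDerivAt_const _ _
  · have hpos : u + t * l ≠ 0 := by positivity
    have h1 : HasDerivAt (fun t : ℝ => u + t * l) l t := by
      simpa using ((hasDerivAt_id t).mul_const l).const_add u
    refine (((h1.log hpos).sub_const (Real.log u)).const_mul (w * l)).congr_deriv ?_
    ring

lemma mul_log_add_mul_le {w l u t : ℝ} (hw : 0 ≤ w) (hl : 0 ≤ l) (hu : 0 ≤ u)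
    (h : w * l = 0 ∨ 0 < u) (ht : 0 < t) :
    w * l * (Real.log (u + t * l) - Real.log u) ≤
      w * l * Real.log t + w * l * (Real.log l - Real.log u) + w * u / t := by
  rcases h with h | h
  · simp only [h, zero_mul, zero_add]
    positivity
  rcases hl.eq_or_lt with rfl | hl
  · simp only [mul_zero, zero_mul, zero_add]
    positivity
  have key : Real.log (u + t * l) ≤ Real.log t + Real.log l + u / (t * l) := by
    rw [← Real.log_mul ht.ne' hl.ne', show u + t * l = (t * l) * (u / (t * l) + 1) by field_simp,
      Real.log_mul (by positivity) (by positivity)]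
    have := Real.log_le_sub_one_of_pos (show 0 < u / (t * l) + 1 by positivity)
    linarith
  have h2 := mul_le_mul_of_nonneg_left key (mul_nonneg hw hl.le)
  have h3 : w * l * (u / (t * l)) = w * u / t := by field_simp
  linear_combination h2 + h3

lemma mul_log_mul_le {P t : ℝ} (hP : 0 ≤ P) (ht : 0 < t) :
    P * Real.log t + P * Real.log P ≤ P * Real.log (1 / 2 + t * P) := by
  rcases hP.eq_or_lt with rfl | hP
  · simp
  rw [← mul_add, ← Real.log_mul ht.ne' hP.ne']
  gcongr
  linarith

/-- A lower bound on a relative entropy with weights, obtained by integrating a family of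
lower bounds on quadratic quotients over the parameter `t`. -/
lemma log_two_sub_binEntropy_le_of_forall {ι : Type*} [Fintype ι] (w l u : ι → ℝ)
    (hw : ∀ i, 0 ≤ w i) (hl : ∀ i, 0 ≤ l i) (hu : ∀ i, 0 ≤ u i)
    (hs : ∀ i, w i * l i = 0 ∨ 0 < u i)
    (hwl : ∑ i, w i * l i = 1) (hwu : ∑ i, w i * u i = 1)
    {P : ℝ} (hP0 : 0 ≤ P) (hP1 : P ≤ 1)
    (H : ∀ t, 0 < t → P ^ 2 / (1 / 2 + t * P) + (1 - P) ^ 2 / (1 / 2 + t * (1 - P)) ≤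
      ∑ i, w i * (l i ^ 2 / (u i + t * l i))) :
    Real.log 2 - Real.binEntropy P ≤ ∑ i, w i * l i * (Real.log (l i) - Real.log (u i)) := by
  have hQ : 0 ≤ 1 - P := by linarith
  set F : ℝ → ℝ := fun t => ∑ i, w i * l i * (Real.log (u i + t * l i) - Real.log (u i)) -
    (1 * P * (Real.log (1 / 2 + t * P) - Real.log (1 / 2)) +
      1 * (1 - P) * (Real.log (1 / 2 + t * (1 - P)) - Real.log (1 / 2))) with hF
  have hder : ∀ t, 0 ≤ t → HasDerivAt F (∑ i, w i * (l i ^ 2 / (u i + t * l i)) -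
      (1 * (P ^ 2 / (1 / 2 + t * P)) + 1 * ((1 - P) ^ 2 / (1 / 2 + t * (1 - P))))) t := by
    intro t ht
    exact (HasDerivAt.fun_sum fun i _ => hasDerivAt_mul_log_add_mul (hl i) (hs i) ht).sub
      ((hasDerivAt_mul_log_add_mul hP0 (Or.inr (by norm_num)) ht).add
        (hasDerivAt_mul_log_add_mul hQ (Or.inr (by norm_num)) ht))
  have hmono : MonotoneOn F (Set.Ici 0) := by
    refine monotoneOn_of_deriv_nonneg (convex_Ici 0)
      (fun t ht => (hder t ht).continuousAt.continuousWithinAt) ?_ ?_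
    · intro t ht
      rw [interior_Ici] at ht
      exact (hder t (le_of_lt ht)).differentiableAt.differentiableWithinAt
    · intro t ht
      rw [interior_Ici] at ht
      rw [(hder t (le_of_lt ht)).deriv]
      have := H t ht
      linarith
  have hF0 : F 0 = 0 := by simp [hF]
  refine le_of_forall_pos_le_add fun ε hε => ?_
  set t := 1 / ε with htdef
  have ht : 0 < t := by positivity
  have h1 : 0 ≤ F t := hF0 ▸ hmono (Set.mem_Ici.2 le_rfl) (Set.mem_Ici.2 ht.le) ht.le
  have h2 : ∑ i, w i * l i * (Real.log (u i + t * l i) - Real.log (u i)) ≤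
      Real.log t + ∑ i, w i * l i * (Real.log (l i) - Real.log (u i)) + ε := by
    calc _ ≤ ∑ i, (w i * l i * Real.log t + w i * l i * (Real.log (l i) - Real.log (u i))
          + w i * u i / t) := Finset.sum_le_sum fun i _ =>
            mul_log_add_mul_le (hw i) (hl i) (hu i) (hs i) ht
      _ = _ := by
        rw [Finset.sum_add_distrib, Finset.sum_add_distrib, ← Finset.sum_mul,
          ← Finset.sum_div, hwl, hwu, htdef]
        simp
  have h3 := mul_log_mul_le hP0 ht
  have h4 := mul_log_mul_le hQ ht
  have h5 : Real.log (1 / 2) = - Real.log 2 := by rw [one_div, Real.log_inv]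
  have h6 : Real.binEntropy P = -(P * Real.log P) - (1 - P) * Real.log (1 - P) := by
    rw [Real.binEntropy_eq_negMulLog_add_negMulLog_one_sub, Real.negMulLog, Real.negMulLog]
    ring
  simp only [hF, h5] at h1
  rw [h6]
  linarith

lemma two_mul_re_sub_le {z y : ℂ} {l u t : ℝ} (hl : 0 ≤ l) (hu : 0 ≤ u) (ht : 0 < t) :
    2 * (l * (y * star z).re) - (u + t * l) * Complex.normSq y ≤
      Complex.normSq z * (l ^ 2 / (u + t * l)) := by
  rcases hl.eq_or_lt with rfl | hl
  · have := mul_nonneg hu (Complex.normSq_nonneg y)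
    simpa using this
  · have hpos : 0 < u + t * l := by positivity
    have h2 := Complex.normSq_nonneg ((l : ℂ) * z - ((u + t * l : ℝ) : ℂ) * y)
    rw [← mul_div_assoc, le_div_iff₀ hpos]
    simp [Complex.normSq_apply] at h2 ⊢
    linarith

section Matrix

variable {n : Type*} [Fintype n] [DecidableEq n]

lemma trace_diagonal_mul_mul_conjTranspose (d : n → ℂ) (Y Z : Matrix n n ℂ) :
    (diagonal d * Y * Zᴴ).trace = ∑ i, ∑ j, d i * (Y i j * star (Z i j)) := by
  refine Finset.sum_congr rfl fun i _ => ?_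
  rw [diag_apply, mul_apply]
  refine Finset.sum_congr rfl fun j _ => ?_
  rw [Matrix.diagonal_mul, conjTranspose_apply, mul_assoc]

lemma trace_mul_diagonal_mul_conjTranspose (d : n → ℂ) (Y Z : Matrix n n ℂ) :
    (Y * diagonal d * Zᴴ).trace = ∑ i, ∑ j, d j * (Y i j * star (Z i j)) := by
  refine Finset.sum_congr rfl fun i _ => ?_
  rw [diag_apply, mul_apply]
  refine Finset.sum_congr rfl fun j _ => ?_
  rw [Matrix.mul_diagonal, conjTranspose_apply]
  ring

open scoped MatrixOrder in
lemma Matrix.PosSemidef.re_trace_mul_nonneg_s8 {A B : Matrix n n ℂ} (hA : A.PosSemidef)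
    (hB : B.PosSemidef) : 0 ≤ (A * B).trace.re := by
  obtain ⟨C, rfl⟩ := CStarAlgebra.nonneg_iff_eq_star_mul_self.mp hA.nonneg
  rw [star_eq_conjTranspose, Matrix.mul_assoc, trace_mul_comm]
  exact (Complex.nonneg_iff.1 (hB.mul_mul_conjTranspose_same C).trace_nonneg).1

lemma Matrix.PosSemidef.sub_mul_self_s8 {F : Matrix n n ℂ} (hF : F.PosSemidef)
    (hF' : (1 - F).PosSemidef) : (F - F * F).PosSemidef := by
  have h := (hF'.conjTranspose_mul_mul_same F).add (hF.conjTranspose_mul_mul_same (1 - F))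
  rw [hF.isHermitian.eq, hF'.isHermitian.eq] at h
  convert h using 1
  noncomm_ring

/-- The change of basis matrix between the eigenbases of two Hermitian matrices. -/
noncomputable def eigenbasisOverlap {A B : Matrix n n ℂ} (hA : A.IsHermitian)
    (hB : B.IsHermitian) : Matrix n n ℂ :=
  (hA.eigenvectorUnitary : Matrix n n ℂ)ᴴ * (hB.eigenvectorUnitary : Matrix n n ℂ)

lemma Matrix.IsHermitian.eq_mul_diagonal_mul {A : Matrix n n ℂ} (hA : A.IsHermitian) :
    A = (hA.eigenvectorUnitary : Matrix n n ℂ) * diagonal (fun i => (hA.eigenvalues i : ℂ)) *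
      (hA.eigenvectorUnitary : Matrix n n ℂ)ᴴ := by
  exact hA.spectral_theorem

lemma eigenvectorUnitary_conjTranspose_mul {A : Matrix n n ℂ} (hA : A.IsHermitian) :
    (hA.eigenvectorUnitary : Matrix n n ℂ)ᴴ * (hA.eigenvectorUnitary : Matrix n n ℂ) = 1 :=
  Unitary.coe_star_mul_self hA.eigenvectorUnitary

lemma eigenvectorUnitary_mul_conjTranspose {A : Matrix n n ℂ} (hA : A.IsHermitian) :
    (hA.eigenvectorUnitary : Matrix n n ℂ) * (hA.eigenvectorUnitary : Matrix n n ℂ)ᴴ = 1 :=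
  Unitary.coe_mul_star_self hA.eigenvectorUnitary

lemma sum_normSq_eigenbasisOverlap {A B : Matrix n n ℂ} (hA : A.IsHermitian)
    (hB : B.IsHermitian) (i : n) :
    ∑ j, Complex.normSq (eigenbasisOverlap hA hB i j) = 1 := by
  have h : eigenbasisOverlap hA hB * (eigenbasisOverlap hA hB)ᴴ = 1 := by
    rw [eigenbasisOverlap, conjTranspose_mul, conjTranspose_conjTranspose, Matrix.mul_assoc,
      ← Matrix.mul_assoc _ _ (hA.eigenvectorUnitary : Matrix n n ℂ),
      eigenvectorUnitary_mul_conjTranspose, Matrix.one_mul, eigenvectorUnitary_conjTranspose_mul]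
  have h2 := congrFun (congrFun h i) i
  rw [mul_apply, one_apply_eq] at h2
  have h3 := congrArg Complex.re h2
  rw [Complex.re_sum] at h3
  simpa [Complex.normSq_apply] using h3

lemma sum_eigenvalues_mul_normSq_eigenbasisOverlap {A B : Matrix n n ℂ} (hA : A.IsHermitian)
    (hB : B.IsHermitian) (j : n) :
    ∑ i, hA.eigenvalues i * Complex.normSq (eigenbasisOverlap hA hB i j) =
      (((hB.eigenvectorUnitary : Matrix n n ℂ)ᴴ * A *
        (hB.eigenvectorUnitary : Matrix n n ℂ)) j j).re := by
  have h : (hB.eigenvectorUnitary : Matrix n n ℂ)ᴴ * A * hB.eigenvectorUnitary =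
      (eigenbasisOverlap hA hB)ᴴ * diagonal (fun i => (hA.eigenvalues i : ℂ)) *
        eigenbasisOverlap hA hB := by
    conv_lhs => rw [hA.eq_mul_diagonal_mul]
    simp only [eigenbasisOverlap, conjTranspose_mul, conjTranspose_conjTranspose, Matrix.mul_assoc]
  rw [h, mul_apply, Complex.re_sum]
  refine Finset.sum_congr rfl fun i _ => ?_
  rw [Matrix.mul_diagonal]
  simp [Complex.normSq_apply]
  ring

lemma eigenvectorUnitary_conj_apply_self {B : Matrix n n ℂ} (hB : B.IsHermitian) (j : n) :
    (((hB.eigenvectorUnitary : Matrix n n ℂ)ᴴ * B *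
        (hB.eigenvectorUnitary : Matrix n n ℂ)) j j).re =
      hB.eigenvalues j := by
  rw [← sum_eigenvalues_mul_normSq_eigenbasisOverlap hB hB, eigenbasisOverlap,
    eigenvectorUnitary_conjTranspose_mul, Finset.sum_eq_single j]
  · simp
  · intro i _ hij
    simp [one_apply_ne hij]
  · simp

lemma trace_mul_eq_sum_eigenbasisOverlap {A B : Matrix n n ℂ} (hA : A.IsHermitian)
    (hB : B.IsHermitian) (X : Matrix n n ℂ) :
    (A * X).trace = ∑ i, ∑ j, (hA.eigenvalues i : ℂ) *
      (((hA.eigenvectorUnitary : Matrix n n ℂ)ᴴ * X *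
        (hB.eigenvectorUnitary : Matrix n n ℂ)) i j *
        star (eigenbasisOverlap hA hB i j)) := by
  rw [← trace_diagonal_mul_mul_conjTranspose]
  conv_lhs => rw [hA.eq_mul_diagonal_mul]
  rw [Matrix.mul_assoc, Matrix.mul_assoc, trace_mul_comm, eigenbasisOverlap, conjTranspose_mul,
    conjTranspose_conjTranspose]
  simp only [Matrix.mul_assoc]
  rw [← Matrix.mul_assoc (hB.eigenvectorUnitary : Matrix n n ℂ),
    eigenvectorUnitary_mul_conjTranspose, Matrix.one_mul]

lemma trace_mul_mul_eq_sum_left {A B X : Matrix n n ℂ} (hA : A.IsHermitian)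
    (hB : B.IsHermitian) (hX : X.IsHermitian) :
    (A * (X * X)).trace.re = ∑ i, ∑ j, hA.eigenvalues i * Complex.normSq
      (((hA.eigenvectorUnitary : Matrix n n ℂ)ᴴ * X *
        (hB.eigenvectorUnitary : Matrix n n ℂ)) i j) := by
  have h : (A * (X * X)).trace = (diagonal (fun i => (hA.eigenvalues i : ℂ)) *
      ((hA.eigenvectorUnitary : Matrix n n ℂ)ᴴ * X *
        (hB.eigenvectorUnitary : Matrix n n ℂ)) *
      ((hA.eigenvectorUnitary : Matrix n n ℂ)ᴴ * X *
        (hB.eigenvectorUnitary : Matrix n n ℂ))ᴴ).trace := by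
    conv_lhs => rw [hA.eq_mul_diagonal_mul]
    rw [Matrix.mul_assoc, Matrix.mul_assoc, trace_mul_comm]
    simp only [conjTranspose_mul, conjTranspose_conjTranspose, hX.eq, Matrix.mul_assoc]
    rw [← Matrix.mul_assoc (hB.eigenvectorUnitary : Matrix n n ℂ),
      eigenvectorUnitary_mul_conjTranspose, Matrix.one_mul]
  rw [h, trace_diagonal_mul_mul_conjTranspose, Complex.re_sum]
  refine Finset.sum_congr rfl fun i _ => ?_
  rw [Complex.re_sum]
  refine Finset.sum_congr rfl fun j _ => ?_
  rw [← starRingEnd_apply, Complex.mul_conj, ← Complex.ofReal_mul, Complex.ofReal_re]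

lemma trace_mul_mul_eq_sum_right {A B X : Matrix n n ℂ} (hA : A.IsHermitian)
    (hB : B.IsHermitian) (hX : X.IsHermitian) :
    (B * (X * X)).trace.re = ∑ i, ∑ j, hB.eigenvalues j * Complex.normSq
      (((hA.eigenvectorUnitary : Matrix n n ℂ)ᴴ * X *
        (hB.eigenvectorUnitary : Matrix n n ℂ)) i j) := by
  have h : (B * (X * X)).trace = (
      ((hA.eigenvectorUnitary : Matrix n n ℂ)ᴴ * X *
        (hB.eigenvectorUnitary : Matrix n n ℂ)) *
      diagonal (fun i => (hB.eigenvalues i : ℂ)) *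
      ((hA.eigenvectorUnitary : Matrix n n ℂ)ᴴ * X *
        (hB.eigenvectorUnitary : Matrix n n ℂ))ᴴ).trace := by
    rw [← Matrix.mul_assoc, trace_mul_comm]
    conv_lhs => rw [hB.eq_mul_diagonal_mul]
    simp only [conjTranspose_mul, conjTranspose_conjTranspose, hX.eq, Matrix.mul_assoc]
    rw [trace_mul_comm (hA.eigenvectorUnitary : Matrix n n ℂ)ᴴ]
    simp only [Matrix.mul_assoc]
    rw [eigenvectorUnitary_mul_conjTranspose, Matrix.mul_one]
  rw [h, trace_mul_diagonal_mul_conjTranspose, Complex.re_sum]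
  refine Finset.sum_congr rfl fun i _ => ?_
  rw [Complex.re_sum]
  refine Finset.sum_congr rfl fun j _ => ?_
  rw [← starRingEnd_apply, Complex.mul_conj, ← Complex.ofReal_mul, Complex.ofReal_re]

/-- The square of an observable built from a two-outcome measurement is dominated by the
observable with squared values. -/
lemma re_trace_mul_sq_le {A F : Matrix n n ℂ} (hA : A.PosSemidef) (hF : F.PosSemidef)
    (hF' : (1 - F).PosSemidef) (c d : ℝ) :
    (A * (((d : ℂ) • 1 + ((c - d : ℝ) : ℂ) • F) * ((d : ℂ) • 1 + ((c - d : ℝ) : ℂ) • F))).trace.re ≤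
      c ^ 2 * (F * A).trace.re + d ^ 2 * (A.trace.re - (F * A).trace.re) := by
  have h := mul_nonneg (sq_nonneg (c - d)) (hA.re_trace_mul_nonneg_s8 (hF.sub_mul_self_s8 hF'))
  have e : A * (((d : ℂ) • 1 + ((c - d : ℝ) : ℂ) • F) * ((d : ℂ) • 1 + ((c - d : ℝ) : ℂ) • F)) =
      ((d ^ 2 : ℝ) : ℂ) • A + ((2 * d * (c - d) : ℝ) : ℂ) • (A * F) +
        (((c - d) ^ 2 : ℝ) : ℂ) • (A * (F * F)) := by
    simp only [add_mul, mul_add, smul_mul_assoc, mul_smul_comm, Matrix.one_mul, Matrix.mul_one]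
    push_cast
    module
  rw [e]
  rw [trace_mul_comm F A]
  simp only [mul_sub, trace_sub, trace_add, trace_smul, smul_eq_mul, Complex.add_re,
    Complex.sub_re, Complex.re_ofReal_mul] at h ⊢
  linarith

lemma le_sum_eigenbasisOverlap {A B F : Matrix n n ℂ} (hA : A.PosSemidef) (hB : B.PosSemidef)
    (hA1 : A.trace = 1) (hB1 : B.trace = 1)
    (hF : F.PosSemidef) (hF' : (1 - F).PosSemidef) (c d : ℝ) {t : ℝ} (ht : 0 < t) :
    2 * (c * (F * A).trace.re + d * (1 - (F * A).trace.re)) -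
      t * (c ^ 2 * (F * A).trace.re + d ^ 2 * (1 - (F * A).trace.re)) -
      (c ^ 2 * (F * B).trace.re + d ^ 2 * (1 - (F * B).trace.re)) ≤
    ∑ i, ∑ j, Complex.normSq (eigenbasisOverlap hA.isHermitian hB.isHermitian i j) *
      (hA.isHermitian.eigenvalues i ^ 2 /
        (hB.isHermitian.eigenvalues j + t * hA.isHermitian.eigenvalues i)) := by
  set X : Matrix n n ℂ := (d : ℂ) • 1 + ((c - d : ℝ) : ℂ) • F with hXdef
  have hX : X.IsHermitian := by
    rw [Matrix.IsHermitian, hXdef, conjTranspose_add, conjTranspose_smul, conjTranspose_smul,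
      hF.isHermitian.eq, conjTranspose_one]
    simp
  have h1 := re_trace_mul_sq_le hA hF hF' c d
  have h2 := re_trace_mul_sq_le hB hF hF' c d
  rw [← hXdef] at h1 h2
  have h3 : (A * X).trace.re = c * (F * A).trace.re + d * (1 - (F * A).trace.re) := by
    rw [hXdef, mul_add, trace_add, mul_smul_comm, mul_smul_comm, trace_smul, trace_smul,
      Matrix.mul_one, hA1, trace_mul_comm A F]
    simp only [smul_eq_mul, Complex.add_re, Complex.re_ofReal_mul, Complex.one_re]
    ring
  rw [hA1, Complex.one_re] at h1
  rw [hB1, Complex.one_re] at h2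
  have h4 : 2 * (A * X).trace.re - t * (A * (X * X)).trace.re - (B * (X * X)).trace.re ≤
      ∑ i, ∑ j, Complex.normSq (eigenbasisOverlap hA.isHermitian hB.isHermitian i j) *
      (hA.isHermitian.eigenvalues i ^ 2 /
        (hB.isHermitian.eigenvalues j + t * hA.isHermitian.eigenvalues i)) := by
    rw [trace_mul_mul_eq_sum_left hA.isHermitian hB.isHermitian hX,
      trace_mul_mul_eq_sum_right hA.isHermitian hB.isHermitian hX,
      trace_mul_eq_sum_eigenbasisOverlap hA.isHermitian hB.isHermitian X]
    simp only [Complex.re_sum, Finset.mul_sum, ← Finset.sum_sub_distrib, Complex.re_ofReal_mul]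
    refine Finset.sum_le_sum fun i _ => Finset.sum_le_sum fun j _ => ?_
    refine le_trans (le_of_eq ?_) (two_mul_re_sub_le
      (y := ((hA.isHermitian.eigenvectorUnitary : Matrix n n ℂ)ᴴ * X *
        (hB.isHermitian.eigenvectorUnitary : Matrix n n ℂ)) i j)
      (hA.eigenvalues_nonneg i) (hB.eigenvalues_nonneg j) ht)
    ring
  have h5 := mul_le_mul_of_nonneg_left h1 ht.le
  linarith

end Matrix

section Entropy

variable {d : ℕ}

/-- The von Neumann entropy of a Hermitian matrix, in nats. -/
noncomputable def vonNeumannEntropy {A : Matrix (Fin d) (Fin d) ℂ} (hA : A.IsHermitian) : ℝ :=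
  ∑ i, Real.negMulLog (hA.eigenvalues i)

lemma IsDensityMatrix.isHermitian {A : Matrix (Fin d) (Fin d) ℂ} (hA : IsDensityMatrix A) :
    A.IsHermitian :=
  hA.1.isHermitian

lemma IsDensityMatrix.eigenvalues_nonneg {A : Matrix (Fin d) (Fin d) ℂ} (hA : IsDensityMatrix A)
    (i : Fin d) : 0 ≤ hA.isHermitian.eigenvalues i :=
  hA.1.eigenvalues_nonneg i

lemma IsDensityMatrix.sum_eigenvalues {A : Matrix (Fin d) (Fin d) ℂ} (hA : IsDensityMatrix A) :
    ∑ i, hA.isHermitian.eigenvalues i = 1 := by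
  have h := hA.isHermitian.trace_eq_sum_eigenvalues
  rw [hA.2] at h
  have h2 := congrArg Complex.re h
  simpa using h2.symm

lemma vonNeumannEntropy_nonneg {A : Matrix (Fin d) (Fin d) ℂ} (hA : IsDensityMatrix A) :
    0 ≤ vonNeumannEntropy hA.isHermitian := by
  refine Finset.sum_nonneg fun i _ => Real.negMulLog_nonneg (hA.eigenvalues_nonneg i) ?_
  rw [← hA.sum_eigenvalues]
  exact Finset.single_le_sum (fun j _ => hA.eigenvalues_nonneg j) (Finset.mem_univ i)

lemma vonNeumannEntropy_le_log {A : Matrix (Fin d) (Fin d) ℂ} (hA : IsDensityMatrix A)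
    (hd : 0 < d) : vonNeumannEntropy hA.isHermitian ≤ Real.log d := by
  have hd' : (0 : ℝ) < d := by exact_mod_cast hd
  have key : ∀ i, Real.negMulLog (hA.isHermitian.eigenvalues i) ≤
      hA.isHermitian.eigenvalues i * Real.log d + (1 / d - hA.isHermitian.eigenvalues i) := by
    intro i
    rcases (hA.eigenvalues_nonneg i).eq_or_lt with h | h
    · rw [← h]
      simp
    · have h2 := Real.log_le_sub_one_of_pos
        (show 0 < 1 / (d * hA.isHermitian.eigenvalues i) by positivity)
      rw [one_div, Real.log_inv, Real.log_mul hd'.ne' h.ne'] at h2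
      have h3 := mul_le_mul_of_nonneg_left h2 h.le
      have h4 : hA.isHermitian.eigenvalues i * (((d : ℝ) * hA.isHermitian.eigenvalues i)⁻¹ - 1) =
        1 / d - hA.isHermitian.eigenvalues i := by field_simp
      rw [Real.negMulLog]
      linarith
  refine (Finset.sum_le_sum fun i _ => key i).trans (le_of_eq ?_)
  rw [Finset.sum_add_distrib, Finset.sum_sub_distrib, ← Finset.sum_mul, hA.sum_eigenvalues]
  simp [hd'.ne']

lemma IsDensityMatrix.re_trace_one_sub_mul {A : Matrix (Fin d) (Fin d) ℂ}
    (hA : IsDensityMatrix A) (E : Matrix (Fin d) (Fin d) ℂ) :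
    ((1 - E) * A).trace.re = 1 - (E * A).trace.re := by
  rw [sub_mul, Matrix.one_mul, trace_sub, hA.2, Complex.sub_re, Complex.one_re]

lemma IsDensityMatrix.sum_normSq_mul_log {A B : Matrix (Fin d) (Fin d) ℂ}
    (hA : IsDensityMatrix A) (hB : IsDensityMatrix B) :
    ∑ i, ∑ j, Complex.normSq (eigenbasisOverlap hA.isHermitian hB.isHermitian i j) *
      hA.isHermitian.eigenvalues i *
      (Real.log (hA.isHermitian.eigenvalues i) - Real.log (hB.isHermitian.eigenvalues j)) =
    - vonNeumannEntropy hA.isHermitian - ∑ j,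
      (((hB.isHermitian.eigenvectorUnitary : Matrix (Fin d) (Fin d) ℂ)ᴴ * A *
        (hB.isHermitian.eigenvectorUnitary : Matrix (Fin d) (Fin d) ℂ)) j j).re *
      Real.log (hB.isHermitian.eigenvalues j) := by
  simp only [mul_sub, Finset.sum_sub_distrib]
  congr 1
  · rw [vonNeumannEntropy, ← Finset.sum_neg_distrib]
    refine Finset.sum_congr rfl fun i _ => ?_
    simp only [mul_assoc]
    rw [← Finset.sum_mul, sum_normSq_eigenbasisOverlap, Real.negMulLog]
    ring
  · rw [Finset.sum_comm]
    refine Finset.sum_congr rfl fun j _ => ?_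
    rw [← Finset.sum_mul, ← sum_eigenvalues_mul_normSq_eigenbasisOverlap hA.isHermitian]
    simp only [mul_comm]

/-- If the two-outcome measurement `E` identifies which of two equally likely states was prepared
with probability at least `p`, then the entropy of their mixture exceeds the mean of their
entropies by at least `log 2 - H(p)` (in nats). -/
lemma vonNeumannEntropy_mixture {A : Bool → Matrix (Fin d) (Fin d) ℂ}
    {B E : Matrix (Fin d) (Fin d) ℂ}
    (hA : ∀ b, IsDensityMatrix (A b)) (hB : IsDensityMatrix B)
    (hAB : B = (1 / 2 : ℝ) • A true + (1 / 2 : ℝ) • A false)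
    (hE : E.PosSemidef) (hE' : (1 - E).PosSemidef) {p : ℝ} (hp : 1 / 2 ≤ p)
    (h1 : p ≤ (E * A true).trace.re) (h0 : p ≤ ((1 - E) * A false).trace.re) :
    1 / 2 * vonNeumannEntropy (hA true).isHermitian +
      1 / 2 * vonNeumannEntropy (hA false).isHermitian + (Real.log 2 - Real.binEntropy p) ≤
      vonNeumannEntropy hB.isHermitian := by
  set r1 := (E * A true).trace.re with hr1
  set r0 := ((1 - E) * A false).trace.re with hr0
  have hr1' : r1 ≤ 1 := by
    have := hE'.re_trace_mul_nonneg_s8 (hA true).1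
    rw [(hA true).re_trace_one_sub_mul] at this
    linarith
  have hr0' : r0 ≤ 1 := by
    have := hE.re_trace_mul_nonneg_s8 (hA false).1
    rw [hr0, (hA false).re_trace_one_sub_mul]
    linarith
  set P := 1 / 2 * r1 + 1 / 2 * r0 with hP
  have hP0 : 0 ≤ P := by linarith
  have hP1 : P ≤ 1 := by linarith
  have hpP : p ≤ P := by linarith
  have hanti : Real.binEntropy P ≤ Real.binEntropy p :=
    Real.binEntropy_strictAntiOn.antitoneOn ⟨by linarith, by linarith⟩ ⟨by linarith, hP1⟩ hpP
  let l : Bool → Fin d → ℝ := fun b => (hA b).isHermitian.eigenvalues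
  let u : Fin d → ℝ := hB.isHermitian.eigenvalues
  let W : Bool → Fin d → Fin d → ℝ := fun b i j =>
    Complex.normSq (eigenbasisOverlap (hA b).isHermitian hB.isHermitian i j)
  let V : Matrix (Fin d) (Fin d) ℂ := hB.isHermitian.eigenvectorUnitary
  have hW : ∀ b i j, 0 ≤ W b i j := fun b i j => Complex.normSq_nonneg _
  have hl : ∀ b i, 0 ≤ l b i := fun b i => (hA b).eigenvalues_nonneg i
  have hu : ∀ j, 0 ≤ u j := fun j => hB.eigenvalues_nonneg j
  have hcol : ∀ b j, ∑ i, l b i * W b i j = ((Vᴴ * A b * V) j j).re := fun b j =>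
    sum_eigenvalues_mul_normSq_eigenbasisOverlap (hA b).isHermitian hB.isHermitian j
  have hmix : ∀ j, 1 / 2 * ((Vᴴ * A true * V) j j).re + 1 / 2 * ((Vᴴ * A false * V) j j).re =
      u j := by
    intro j
    have h := eigenvectorUnitary_conj_apply_self hB.isHermitian j
    have e : Vᴴ * B * V =
        (1 / 2 : ℝ) • (Vᴴ * A true * V) + (1 / 2 : ℝ) • (Vᴴ * A false * V) := by
      rw [hAB]
      simp only [mul_add, add_mul, mul_smul_comm, smul_mul_assoc]
    change ((Vᴴ * B * V) j j).re = u j at h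
    rw [e] at h
    simpa using h
  have hsum : ∀ b, ∑ i, ∑ j, W b i j * l b i = 1 := by
    intro b
    rw [← (hA b).sum_eigenvalues]
    refine Finset.sum_congr rfl fun i _ => ?_
    rw [← Finset.sum_mul, sum_normSq_eigenbasisOverlap, one_mul]
  have hsumu : ∀ b, ∑ i, ∑ j, W b i j * u j = 1 := by
    intro b
    have h := trace_mul_mul_eq_sum_right (hA b).isHermitian hB.isHermitian
      (Matrix.isHermitian_one (n := Fin d) (α := ℂ))
    simp only [Matrix.mul_one, hB.2, Complex.one_re, mul_comm (hB.isHermitian.eigenvalues _)] at h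
    exact h.symm
  have hsupp : ∀ b i j, W b i j * l b i = 0 ∨ 0 < u j := by
    intro b i j
    rcases (hu j).eq_or_lt with h | h
    · left
      have hm := hmix j
      rw [← h, ← hcol, ← hcol] at hm
      have hnn : ∀ b i, 0 ≤ l b i * W b i j := fun b i => mul_nonneg (hl b i) (hW b i j)
      have hnn' : ∀ b, 0 ≤ ∑ i, l b i * W b i j := fun b => Finset.sum_nonneg fun i _ => hnn b i
      have hz : ∑ i, l b i * W b i j = 0 := by
        have := hnn' true
        have := hnn' false
        cases b <;> linarith
      rw [mul_comm]
      exact (Finset.sum_eq_zero_iff_of_nonneg fun i _ => hnn b i).1 hz i (Finset.mem_univ i)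
    · exact Or.inr h
  have hquad : ∀ t, 0 < t →
      P ^ 2 / (1 / 2 + t * P) + (1 - P) ^ 2 / (1 / 2 + t * (1 - P)) ≤
      1 / 2 * (∑ i, ∑ j, W true i j * (l true i ^ 2 / (u j + t * l true i))) +
      1 / 2 * (∑ i, ∑ j, W false i j * (l false i ^ 2 / (u j + t * l false i))) := by
    intro t ht
    have hQ : 0 ≤ 1 - P := by linarith
    have hx : 0 < 1 / 2 + t * P := by positivity
    have hy : 0 < 1 / 2 + t * (1 - P) := by positivity
    have k1 := le_sum_eigenbasisOverlap (hA true).1 hB.1 (hA true).2 hB.2 hE hE'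
      (P / (1 / 2 + t * P)) ((1 - P) / (1 / 2 + t * (1 - P))) ht
    have k0 := le_sum_eigenbasisOverlap (hA false).1 hB.1 (hA false).2 hB.2 hE'
      (by rwa [sub_sub_cancel]) (P / (1 / 2 + t * P)) ((1 - P) / (1 / 2 + t * (1 - P))) ht
    rw [← hr1] at k1
    rw [← hr0, hB.re_trace_one_sub_mul] at k0
    change _ ≤ ∑ i, ∑ j, W true i j * (l true i ^ 2 / (u j + t * l true i)) at k1
    change _ ≤ ∑ i, ∑ j, W false i j * (l false i ^ 2 / (u j + t * l false i)) at k0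
    have e : ∀ x, 0 < 1 / 2 + t * x → x ^ 2 / (1 / 2 + t * x) =
        2 * (x / (1 / 2 + t * x)) * x - (1 / 2 + t * x) * (x / (1 / 2 + t * x)) ^ 2 := by
      intro x hx
      field_simp
      ring
    rw [e P hx, e (1 - P) hy]
    generalize P / (1 / 2 + t * P) = c at *
    generalize (1 - P) / (1 / 2 + t * (1 - P)) = c' at *
    rw [hP]
    linarith
  have hfinal := log_two_sub_binEntropy_le_of_forall (ι := Bool × Fin d × Fin d)
    (fun x => 1 / 2 * W x.1 x.2.1 x.2.2) (fun x => l x.1 x.2.1) (fun x => u x.2.2)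
    (fun x => mul_nonneg (by norm_num) (hW _ _ _)) (fun x => hl _ _) (fun x => hu _)
    (fun x => (hsupp x.1 x.2.1 x.2.2).imp_left fun h => by rw [mul_assoc, h, mul_zero])
    (by
      simp only [Fintype.sum_prod_type, Fintype.sum_bool, mul_assoc, ← Finset.mul_sum, hsum]
      norm_num)
    (by
      simp only [Fintype.sum_prod_type, Fintype.sum_bool, mul_assoc, ← Finset.mul_sum, hsumu]
      norm_num)
    hP0 hP1
    (fun t ht => by
      simp only [Fintype.sum_prod_type, Fintype.sum_bool, mul_assoc, ← Finset.mul_sum]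
      exact (hquad t ht).trans_eq (mul_add _ _ _).symm)
  have hlog : ∀ b, ∑ i, ∑ j, W b i j * (l b i * (Real.log (l b i) - Real.log (u j))) =
      - vonNeumannEntropy (hA b).isHermitian -
        ∑ j, ((Vᴴ * A b * V) j j).re * Real.log (u j) := by
    intro b
    simp only [← mul_assoc]
    exact (hA b).sum_normSq_mul_log hB
  simp only [Fintype.sum_prod_type, Fintype.sum_bool, mul_assoc, ← Finset.mul_sum] at hfinal
  rw [hlog, hlog] at hfinal
  have hSB : vonNeumannEntropy hB.isHermitian =
      - (1 / 2 * (∑ j, ((Vᴴ * A true * V) j j).re * Real.log (u j)) +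
      1 / 2 * (∑ j, ((Vᴴ * A false * V) j j).re * Real.log (u j))) := by
    rw [vonNeumannEntropy, Finset.mul_sum, Finset.mul_sum, ← Finset.sum_add_distrib,
      ← Finset.sum_neg_distrib]
    refine Finset.sum_congr rfl fun j _ => ?_
    rw [← mul_assoc, ← mul_assoc, ← add_mul, hmix, Real.negMulLog]
    exact neg_mul _ _
  linarith

lemma convex_isDensityMatrix :
    Convex ℝ {A : Matrix (Fin d) (Fin d) ℂ | IsDensityMatrix A} := by
  intro A hA B hB a b ha hb hab
  refine ⟨(hA.1.smul ha).add (hB.1.smul hb), ?_⟩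
  rw [trace_add, trace_smul, trace_smul, hA.2, hB.2, ← add_smul, hab, one_smul]

lemma convex_le_re_trace_mul (E : Matrix (Fin d) (Fin d) ℂ) (p : ℝ) :
    Convex ℝ {A : Matrix (Fin d) (Fin d) ℂ | p ≤ (E * A).trace.re} := by
  intro A hA B hB a b ha hb hab
  have h1 := mul_le_mul_of_nonneg_left (show p ≤ (E * A).trace.re from hA) ha
  have h2 := mul_le_mul_of_nonneg_left (show p ≤ (E * B).trace.re from hB) hb
  change p ≤ (E * (a • A + b • B)).trace.re
  simp only [mul_add, mul_smul_comm, trace_add, trace_smul, Complex.add_re,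
    Complex.smul_re, smul_eq_mul]
  have h3 : p = a * p + b * p := by rw [← add_mul, hab, one_mul]
  linarith

/-- The entropy bound for serial encodings, where the `i`-th measurement is indexed by the whole
string but depends only on the bits after position `i`. -/
lemma exists_mem_convexHull_le_vonNeumannEntropy {p : ℝ} (hp : 1 / 2 ≤ p) (n : ℕ)
    (f : (Fin n → Bool) → Matrix (Fin d) (Fin d) ℂ) (hf : ∀ x, IsDensityMatrix (f x))
    (E : Fin n → (Fin n → Bool) → Matrix (Fin d) (Fin d) ℂ)
    (hE : ∀ i x, (E i x).PosSemidef ∧ (1 - E i x).PosSemidef)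
    (hdep : ∀ i x y, (∀ j, i < j → x j = y j) → E i x = E i y)
    (hmeas : ∀ x i, (x i = true → p ≤ (E i x * f x).trace.re) ∧
      (x i = false → p ≤ ((1 - E i x) * f x).trace.re)) :
    ∃ A ∈ convexHull ℝ (Set.range f), ∃ hA : IsDensityMatrix A,
      n * (Real.log 2 - Real.binEntropy p) ≤ vonNeumannEntropy hA.isHermitian := by
  induction n with
  | zero =>
    refine ⟨f 0, subset_convexHull ℝ _ ⟨0, rfl⟩, hf 0, ?_⟩
    simpa using vonNeumannEntropy_nonneg (hf 0)
  | succ n ih =>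
    have key : ∀ b : Bool, ∃ A ∈ convexHull ℝ (Set.range fun x : Fin n → Bool =>
        f (Fin.snoc x b : Fin (n + 1) → Bool)), ∃ hA : IsDensityMatrix A,
        n * (Real.log 2 - Real.binEntropy p) ≤ vonNeumannEntropy hA.isHermitian := by
      intro b
      refine ih _ (fun x => hf _) (fun i x => E i.castSucc (Fin.snoc x b : Fin (n + 1) → Bool))
        (fun i x => hE _ _) ?_ ?_
      · intro i x y hxy
        refine hdep _ _ _ fun j => ?_
        refine Fin.lastCases (fun _ => ?_) (fun j hj => ?_) j
        · simp
        · simpa using hxy j (by simpa using hj)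
      · intro x i
        simpa using hmeas (Fin.snoc x b : Fin (n + 1) → Bool) i.castSucc
    choose A hAmem hA hS using key
    have hAf : ∀ b, A b ∈ convexHull ℝ (Set.range f) := fun b =>
      convexHull_mono (by rintro _ ⟨x, rfl⟩; exact ⟨_, rfl⟩) (hAmem b)
    set B := (1 / 2 : ℝ) • A true + (1 / 2 : ℝ) • A false with hBdef
    have hB : IsDensityMatrix B := convex_isDensityMatrix (hA true) (hA false)
      (by norm_num) (by norm_num) (by norm_num)
    have hlast : ∀ x, E (Fin.last n) x = E (Fin.last n) default := fun x =>
      hdep _ _ _ fun j hj => absurd hj (not_lt.2 (Fin.le_last j))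
    have h1 : p ≤ (E (Fin.last n) default * A true).trace.re := by
      refine convexHull_min ?_ (convex_le_re_trace_mul (E (Fin.last n) default) p) (hAmem true)
      rintro _ ⟨x, rfl⟩
      have := (hmeas (Fin.snoc x true : Fin (n + 1) → Bool) (Fin.last n)).1 (by simp)
      rwa [hlast] at this
    have h0 : p ≤ ((1 - E (Fin.last n) default) * A false).trace.re := by
      refine convexHull_min ?_ (convex_le_re_trace_mul (1 - E (Fin.last n) default) p)
        (hAmem false)
      rintro _ ⟨x, rfl⟩
      have := (hmeas (Fin.snoc x false : Fin (n + 1) → Bool) (Fin.last n)).2 (by simp)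
      rwa [hlast] at this
    refine ⟨B, convex_convexHull ℝ _ (hAf true) (hAf false) (by norm_num) (by norm_num)
      (by norm_num), hB, ?_⟩
    have := vonNeumannEntropy_mixture hA hB hBdef (hE _ default).1 (hE _ default).2 hp h1 h0
    have := hS true
    have := hS false
    push_cast
    linarith

end Entropy

lemma binH_eq_binEntropy_div_log_two (p : ℝ) : binH p = Real.binEntropy p / Real.log 2 := by
  rw [binH, Real.logb, Real.logb, Real.binEntropy_eq_negMulLog_add_negMulLog_one_sub,
    Real.negMulLog, Real.negMulLog]
  ring

/-- Theorem 3: any `(n,m,p)`-random access (or serial) encoding, i.e. a map `f` from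
`{0,1}^n` to density matrices over `m` qubits together with two-outcome measurements
`E i s` (allowed to depend on the suffix `s` of bits after position `i`) recovering
the `i`-th bit with probability at least `p`, must have `m ≥ (1 − H(p))·n`. -/
theorem random_access_code_lower_bound (n m : ℕ) (p : ℝ) (hp : 1 / 2 ≤ p) (hp1 : p ≤ 1)
    (f : (Fin n → Bool) → Matrix (Fin (2 ^ m)) (Fin (2 ^ m)) ℂ)
    (hf : ∀ x, IsDensityMatrix (f x))
    (E : (i : Fin n) → (Fin (n - 1 - i.val) → Bool) → Matrix (Fin (2 ^ m)) (Fin (2 ^ m)) ℂ)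
    (hE : ∀ i s, (E i s).PosSemidef ∧ (1 - E i s).PosSemidef)
    (hmeas : ∀ (x : Fin n → Bool) (i : Fin n),
      (x i = true → p ≤ ((E i (suffixAfter x i) * f x).trace).re) ∧
      (x i = false → p ≤ (((1 - E i (suffixAfter x i)) * f x).trace).re)) :
    (m : ℝ) ≥ (1 - binH p) * n := by
  have hlog : 0 < Real.log 2 := Real.log_pos one_lt_two
  obtain ⟨A, -, hA, hS⟩ := exists_mem_convexHull_le_vonNeumannEntropy hp n f hf
    (fun i x => E i (suffixAfter x i)) (fun i x => hE i _)
    (fun i x y hxy => by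
      have : suffixAfter x i = suffixAfter y i := by
        funext j
        exact hxy _ (Fin.lt_def.2 (by simp only; omega))
      simp only [this])
    hmeas
  have h := hS.trans (vonNeumannEntropy_le_log hA (by positivity))
  rw [Nat.cast_pow, Nat.cast_ofNat, Real.log_pow] at h
  have e : (1 - binH p) * n * Real.log 2 = n * (Real.log 2 - Real.binEntropy p) := by
    rw [binH_eq_binEntropy_div_log_two]
    field_simp
  rw [ge_iff_le, ← mul_le_mul_iff_left₀ hlog, e]
  exact h
end
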